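/- arXiv:2511.05087 — 2 statements merged into one kernel-verified Lean document; each statement's English description precedes it below -/
import Mathlib

section
/- Let H = 3/4. Then, as T → ∞, N(T) = (9/8)·[(T−1)·log T + (c + (π−3)/2)·T + 1 − c − 13π/16 + 1/T] + O(T^{−2}), where c = 2·log 2 + γ and γ is the Euler–Mascheroni constant. -/
open Real MeasureTheory intervalIntegral

/-- `fBmNormSq H T` is the squared norm `‖f_T‖²` expressed as the fourfold integral,
for `H ∈ (1/2,1)`. -/
noncomputable def fBmNormSq (H T : ℝ) : ℝ :=
  H ^ 2 * (2 * H - 1) ^ 2 *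
    ∫ t₁ in (0:ℝ)..T, ∫ t₂ in (0:ℝ)..T, ∫ s₁ in (0:ℝ)..T, ∫ s₂ in (0:ℝ)..T,
      Real.exp (-|t₁ - s₁| - |t₂ - s₂|) * |t₂ - t₁| ^ (2 * H - 2) * |s₁ - s₂| ^ (2 * H - 2)

section
open Set

theorem measurable_lintegral_Ioc_zero {α : Type*} [MeasurableSpace α] {b : α → ℝ}
    {f : α → ℝ → ENNReal} (hb : Measurable b) (hf : Measurable fun p : α × ℝ => f p.1 p.2) :
    Measurable fun z => ∫⁻ y in Ioc 0 (b z), f z y := by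
  have h : ∀ z, ∫⁻ y in Ioc 0 (b z), f z y
      = ∫⁻ y, {p : α × ℝ | 0 < p.2 ∧ p.2 ≤ b p.1}.indicator (fun p => f p.1 p.2) (z, y) := by
    intro z
    rw [← lintegral_indicator measurableSet_Ioc]
    rfl
  simp_rw [h]
  apply Measurable.lintegral_prod_right
  apply hf.indicator
  exact (measurableSet_lt measurable_const measurable_snd).inter
    (measurableSet_le measurable_snd (hb.comp measurable_fst))

/-- Exchanging the order of integration over a triangle. -/
theorem lintegral_Ioc_triangle_swap {f : ℝ → ℝ → ENNReal}
    (hf : Measurable fun p : ℝ × ℝ => f p.1 p.2) (T : ℝ) :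
    ∫⁻ m in Ioc 0 T, ∫⁻ y in Ioc 0 m, f y m = ∫⁻ x in Ioc 0 T, ∫⁻ y in Ioc x T, f x y := by
  have ha : ∀ m : ℝ, ∫⁻ y in Ioc 0 m, f y m = ∫⁻ y in Ioo 0 m, f y m := fun m => by
    rw [restrict_Ioo_eq_restrict_Ioc]
  simp_rw [ha]
  let S : Set (ℝ × ℝ) := {p | (0 < p.1 ∧ p.1 < p.2) ∧ p.2 ≤ T}
  have hS : MeasurableSet S :=
    ((measurableSet_lt measurable_const measurable_fst).inter
      (measurableSet_lt measurable_fst measurable_snd)).inter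
      (measurableSet_le measurable_snd measurable_const)
  have hb : ∫⁻ m in Ioc 0 T, ∫⁻ y in Ioo 0 m, f y m
      = ∫⁻ m, ∫⁻ y, S.indicator (fun p => f p.1 p.2) (y, m) := by
    rw [← lintegral_indicator measurableSet_Ioc]
    refine lintegral_congr fun m => ?_
    by_cases hm : m ∈ Ioc 0 T
    · rw [indicator_of_mem hm, ← lintegral_indicator measurableSet_Ioo]
      refine lintegral_congr fun y => ?_
      simp only [indicator, S, mem_Ioo, mem_ofPred_eq, hm.2, and_true]
    · rw [indicator_of_notMem hm]
      symm
      refine (lintegral_congr (g := fun _ => 0) fun y => ?_).trans lintegral_zero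
      apply indicator_of_notMem
      rintro ⟨⟨h3, h4⟩, h5⟩
      exact hm ⟨h3.trans h4, h5⟩
  have hc : ∫⁻ x in Ioc 0 T, ∫⁻ y in Ioc x T, f x y
      = ∫⁻ x, ∫⁻ y, S.indicator (fun p => f p.1 p.2) (x, y) := by
    rw [← lintegral_indicator measurableSet_Ioc]
    refine lintegral_congr fun m => ?_
    by_cases hm : m ∈ Ioc 0 T
    · rw [indicator_of_mem hm, ← lintegral_indicator measurableSet_Ioc]
      refine lintegral_congr fun y => ?_
      simp only [indicator, S, mem_Ioc, mem_ofPred_eq, hm.1, true_and]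
    · rw [indicator_of_notMem hm]
      symm
      refine (lintegral_congr (g := fun _ => 0) fun y => ?_).trans lintegral_zero
      apply indicator_of_notMem
      rintro ⟨⟨h3, h4⟩, h5⟩
      exact hm ⟨h3, h4.le.trans h5⟩
  rw [hb, hc, lintegral_lintegral_swap]
  exact ((hf.indicator hS).comp measurable_swap).aemeasurable

/-- Splitting a square along its diagonal. -/
theorem lintegral_Ioc_square_split {f : ℝ → ℝ → ENNReal}
    (hf : Measurable fun p : ℝ × ℝ => f p.1 p.2) (T : ℝ) :
    ∫⁻ x in Ioc 0 T, ∫⁻ y in Ioc 0 T, f x y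
      = ∫⁻ m in Ioc 0 T, ∫⁻ y in Ioc 0 m, (f m y + f y m) := by
  have h1 : ∀ m : ℝ, ∫⁻ y in Ioc 0 m, (f m y + f y m)
      = (∫⁻ y in Ioc 0 m, f m y) + ∫⁻ y in Ioc 0 m, f y m := fun m =>
    lintegral_add_left (hf.comp measurable_prodMk_left) _
  simp_rw [h1]
  have hg : Measurable fun m => ∫⁻ y in Ioc 0 m, f m y :=
    measurable_lintegral_Ioc_zero measurable_id hf
  rw [lintegral_add_left hg]
  rw [lintegral_Ioc_triangle_swap hf, ← lintegral_add_left hg]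
  refine setLIntegral_congr_fun measurableSet_Ioc fun x hx => ?_
  rw [← lintegral_union measurableSet_Ioc (Ioc_disjoint_Ioc_of_le le_rfl), Ioc_union_Ioc_eq_Ioc hx.1.le hx.2]

/-- Splitting a cube according to which coordinate is the largest. -/
theorem lintegral_Ioc_cube_split {f : ℝ → ℝ → ℝ → ENNReal}
    (hf : Measurable fun p : ℝ × ℝ × ℝ => f p.1 p.2.1 p.2.2) (T : ℝ) :
    ∫⁻ x in Ioc 0 T, ∫⁻ y in Ioc 0 T, ∫⁻ z in Ioc 0 T, f x y z
      = ∫⁻ m in Ioc 0 T, ((∫⁻ y in Ioc 0 m, ∫⁻ z in Ioc 0 m, f m y z)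
          + (∫⁻ x in Ioc 0 m, ∫⁻ z in Ioc 0 m, f x m z)
          + ∫⁻ x in Ioc 0 m, ∫⁻ y in Ioc 0 m, f x y m) := by
  let h : ℝ → ℝ → ENNReal := fun m z => ∫⁻ y in Ioc 0 m, (f m y z + f y m z)
  have hm : Measurable fun p : ℝ × ℝ => h p.1 p.2 := by
    refine measurable_lintegral_Ioc_zero (f := fun p y => f p.1 y p.2 + f y p.1 p.2)
      measurable_fst ?_
    refine Measurable.add ?_ ?_
    · exact hf.comp (f := fun q : (ℝ × ℝ) × ℝ => (q.1.1, q.2, q.1.2)) (by fun_prop)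
    · exact hf.comp (f := fun q : (ℝ × ℝ) × ℝ => (q.2, q.1.1, q.1.2)) (by fun_prop)
  have hf1 : ∀ m, Measurable fun q : ℝ × ℝ => f m q.1 q.2 := fun m =>
    hf.comp (f := fun q : ℝ × ℝ => (m, q.1, q.2)) (by fun_prop)
  have hf2 : ∀ m, Measurable fun q : ℝ × ℝ => f q.1 m q.2 := fun m =>
    hf.comp (f := fun q : ℝ × ℝ => (q.1, m, q.2)) (by fun_prop)
  have hf3 : ∀ m, Measurable fun q : ℝ × ℝ => f q.1 q.2 m := fun m =>
    hf.comp (f := fun q : ℝ × ℝ => (q.1, q.2, m)) (by fun_prop)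
  have hg : Measurable fun p : ℝ × ℝ => ∫⁻ z in Ioc 0 T, f p.1 p.2 z :=
    measurable_lintegral_Ioc_zero (b := fun _ => T) (f := fun p : ℝ × ℝ => f p.1 p.2)
      measurable_const
      (hf.comp (f := fun q : (ℝ × ℝ) × ℝ => (q.1.1, q.1.2, q.2)) (by fun_prop))
  calc _ = ∫⁻ m in Ioc 0 T, ∫⁻ y in Ioc 0 m,
        ((∫⁻ z in Ioc 0 T, f m y z) + ∫⁻ z in Ioc 0 T, f y m z) :=
        lintegral_Ioc_square_split hg T
    _ = ∫⁻ m in Ioc 0 T, ∫⁻ z in Ioc 0 T, h m z := by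
        refine lintegral_congr fun m => ?_
        rw [lintegral_lintegral_swap (((hf1 m).comp measurable_swap).add
          ((hf2 m).comp measurable_swap)).aemeasurable]
        refine lintegral_congr fun y => ?_
        exact (lintegral_add_left ((hf1 m).comp measurable_prodMk_left) _).symm
    _ = ∫⁻ m in Ioc 0 T, ∫⁻ z in Ioc 0 m, (h m z + h z m) := lintegral_Ioc_square_split hm T
    _ = _ := by
        refine lintegral_congr fun m => ?_
        have hmm : Measurable fun z => h m z := hm.comp measurable_prodMk_left
        rw [lintegral_add_left hmm]
        congr 1
        · rw [lintegral_lintegral_swap (((hf1 m).comp measurable_swap).add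
            ((hf2 m).comp measurable_swap)).aemeasurable,
            ← lintegral_add_left (measurable_lintegral_Ioc_zero (b := fun _ => m)
              measurable_const (hf1 m))]
          refine lintegral_congr fun y => ?_
          exact lintegral_add_left ((hf1 m).comp measurable_prodMk_left) _
        · exact (lintegral_Ioc_square_split (hf3 m) m).symm

/-- For an integrand invariant under a transitive group of permutations of the coordinates, the
integral over a four-dimensional cube is four times that over the part where the first
coordinate is the largest. -/
theorem lintegral_Ioc_tesseract_split {w : ℝ → ℝ → ℝ → ℝ → ENNReal}
    (hw : Measurable fun p : ℝ × ℝ × ℝ × ℝ => w p.1 p.2.1 p.2.2.1 p.2.2.2)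
    (h12 : ∀ a b c d, w a b c d = w b a d c) (hts : ∀ a b c d, w a b c d = w c d a b) (T : ℝ) :
    ∫⁻ a in Ioc 0 T, ∫⁻ b in Ioc 0 T, ∫⁻ c in Ioc 0 T, ∫⁻ d in Ioc 0 T, w a b c d
      = 4 * ∫⁻ m in Ioc 0 T, ∫⁻ d in Ioc 0 m, ∫⁻ b in Ioc 0 m, ∫⁻ c in Ioc 0 m, w m b c d := by
  have hw' : ∀ {α : Type} [MeasurableSpace α] {a b c d : α → ℝ}, Measurable a → Measurable b →
      Measurable c → Measurable d → Measurable fun x => w (a x) (b x) (c x) (d x) :=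
    fun ha hb hc hd => hw.comp (ha.prodMk (hb.prodMk (hc.prodMk hd)))
  have hint : ∀ {α : Type} [MeasurableSpace α] {a d : α → ℝ} (t : ℝ), Measurable a →
      Measurable d → Measurable fun x => ∫⁻ b in Ioc 0 t, ∫⁻ c in Ioc 0 t, w (a x) b c (d x) := by
    intro α _ a d t ha hd
    refine measurable_lintegral_Ioc_zero (b := fun _ => t)
      (f := fun x b => ∫⁻ c in Ioc 0 t, w (a x) b c (d x)) measurable_const ?_
    refine measurable_lintegral_Ioc_zero (b := fun _ => t)
      (f := fun p : α × ℝ => fun c => w (a p.1) p.2 c (d p.1)) measurable_const ?_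
    exact hw' (by fun_prop) (by fun_prop) (by fun_prop) (by fun_prop)
  let H : ℝ → ℝ → ENNReal := fun m n =>
    ∫⁻ d in Ioc 0 m, ∫⁻ y in Ioc 0 n, (w m n y d + w m y n d)
  have hH : Measurable fun p : ℝ × ℝ => H p.1 p.2 := by
    refine measurable_lintegral_Ioc_zero
      (f := fun (p : ℝ × ℝ) d => ∫⁻ y in Ioc 0 p.2, (w p.1 p.2 y d + w p.1 y p.2 d))
      measurable_fst ?_
    refine measurable_lintegral_Ioc_zero (b := fun p : (ℝ × ℝ) × ℝ => p.1.2)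
      (f := fun (p : (ℝ × ℝ) × ℝ) y => w p.1.1 p.1.2 y p.2 + w p.1.1 y p.1.2 p.2)
      (by fun_prop) ?_
    exact (hw' (by fun_prop) (by fun_prop) (by fun_prop) (by fun_prop)).add
      (hw' (by fun_prop) (by fun_prop) (by fun_prop) (by fun_prop))
  have hHm : ∀ m t : ℝ, ∫⁻ n in Ioc 0 t, ∫⁻ d in Ioc 0 m, ∫⁻ y in Ioc 0 n, (w m n y d + w m y n d)
      = ∫⁻ d in Ioc 0 m, ∫⁻ b in Ioc 0 t, ∫⁻ c in Ioc 0 t, w m b c d := by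
    intro m t
    rw [lintegral_lintegral_swap]
    · refine lintegral_congr fun d => ?_
      exact (lintegral_Ioc_square_split (f := fun b c => w m b c d)
        (hw' (by fun_prop) (by fun_prop) (by fun_prop) (by fun_prop)) t).symm
    · refine (measurable_lintegral_Ioc_zero (b := fun p : ℝ × ℝ => p.1)
        (f := fun (p : ℝ × ℝ) y => w m p.1 y p.2 + w m y p.1 p.2) (by fun_prop) ?_).aemeasurable
      exact (hw' (by fun_prop) (by fun_prop) (by fun_prop) (by fun_prop)).add
        (hw' (by fun_prop) (by fun_prop) (by fun_prop) (by fun_prop))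
  have hdiag : ∀ a t : ℝ, ∫⁻ b in Ioc 0 t, ∫⁻ c in Ioc 0 t, ∫⁻ d in Ioc 0 t, w a b c d
      = ∫⁻ d in Ioc 0 t, ∫⁻ b in Ioc 0 t, ∫⁻ c in Ioc 0 t, w a b c d := by
    intro a t
    rw [← lintegral_lintegral_swap (f := fun b d => ∫⁻ c in Ioc 0 t, w a b c d)]
    · refine lintegral_congr fun b => ?_
      rw [lintegral_lintegral_swap]
      exact (hw' (by fun_prop) (by fun_prop) (by fun_prop) (by fun_prop)).aemeasurable
    · refine (measurable_lintegral_Ioc_zero (b := fun _ => t)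
        (f := fun (p : ℝ × ℝ) c => w a p.1 c p.2) measurable_const ?_).aemeasurable
      exact hw' (by fun_prop) (by fun_prop) (by fun_prop) (by fun_prop)
  calc _ = ∫⁻ a in Ioc 0 T, ∫⁻ d in Ioc 0 T, ∫⁻ b in Ioc 0 T, ∫⁻ c in Ioc 0 T, w a b c d :=
        lintegral_congr fun a => hdiag a T
    _ = ∫⁻ m in Ioc 0 T, ∫⁻ d in Ioc 0 m, ((∫⁻ b in Ioc 0 T, ∫⁻ c in Ioc 0 T, w m b c d)
          + ∫⁻ b in Ioc 0 T, ∫⁻ c in Ioc 0 T, w d b c m) :=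
        lintegral_Ioc_square_split (hint T measurable_fst measurable_snd) T
    _ = ∫⁻ m in Ioc 0 T, 2 * ∫⁻ n in Ioc 0 T, H m n := by
        refine lintegral_congr fun m => ?_
        have hmeas : Measurable fun d => ∫⁻ b in Ioc 0 T, ∫⁻ c in Ioc 0 T, w m b c d :=
          hint T measurable_const measurable_id
        rw [hHm m T, ← lintegral_const_mul _ hmeas]
        refine lintegral_congr fun d => ?_
        rw [two_mul]
        congr 1
        rw [lintegral_lintegral_swap]
        · refine lintegral_congr fun b => lintegral_congr fun c => ?_
          rw [h12, hts]
        · exact (hw' (by fun_prop) (by fun_prop) (by fun_prop) (by fun_prop)).aemeasurable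
    _ = 2 * ∫⁻ m in Ioc 0 T, ∫⁻ n in Ioc 0 T, H m n :=
        lintegral_const_mul _ (measurable_lintegral_Ioc_zero (b := fun _ => T) measurable_const hH)
    _ = 2 * ∫⁻ m in Ioc 0 T, ∫⁻ n in Ioc 0 m, (H m n + H n m) := by
        rw [lintegral_Ioc_square_split hH]
    _ = 2 * ∫⁻ m in Ioc 0 T, 2 * ∫⁻ d in Ioc 0 m, ∫⁻ b in Ioc 0 m, ∫⁻ c in Ioc 0 m, w m b c d := by
        congr 1
        refine lintegral_congr fun m => ?_
        have hmeas : Measurable fun n => H m n := hH.comp measurable_prodMk_left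
        rw [lintegral_add_left hmeas, two_mul]
        congr 1
        · exact hHm m m
        · rw [← hHm m m]
          have hsym : ∀ n : ℝ, H n m = ∫⁻ y in Ioc 0 m, ∫⁻ d in Ioc 0 n, (w m n d y + w m d n y) := by
            intro n
            rw [← lintegral_lintegral_swap]
            · refine lintegral_congr fun d => lintegral_congr fun y => ?_
              rw [h12 n m y d, hts n y m d]
            · exact ((hw' (by fun_prop) (by fun_prop) (by fun_prop) (by fun_prop)).add
                (hw' (by fun_prop) (by fun_prop) (by fun_prop) (by fun_prop))).aemeasurable
          exact lintegral_congr hsym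
    _ = _ := by
        rw [lintegral_const_mul, ← mul_assoc]
        · norm_num
        · refine measurable_lintegral_Ioc_zero measurable_id ?_
          refine measurable_lintegral_Ioc_zero measurable_fst ?_
          refine measurable_lintegral_Ioc_zero (b := fun p : (ℝ × ℝ) × ℝ => p.1.1) (by fun_prop) ?_
          exact hw' (by fun_prop) (by fun_prop) (by fun_prop) (by fun_prop)
end

section
open Set

/-- The fundamental theorem of calculus for nonnegative derivatives, as a Lebesgue integral. -/
theorem lintegral_Ioc_eq_of_hasDerivAt {F f : ℝ → ℝ} {g : ℝ → ENNReal} {a b : ℝ} (hab : a ≤ b)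
    (hc : ContinuousOn F (Icc a b)) (hd : ∀ x ∈ Ioo a b, HasDerivAt F (f x) x)
    (hf : ∀ x ∈ Ioo a b, 0 ≤ f x) (hg : ∀ x ∈ Ioo a b, g x = ENNReal.ofReal (f x)) :
    F a ≤ F b ∧ ∫⁻ x in Ioc a b, g x = ENNReal.ofReal (F b - F a) := by
  have hint : IntegrableOn f (Ioc a b) := integrableOn_deriv_of_nonneg hc hd hf
  have h1 : ∫ x in a..b, f x = F b - F a :=
    integral_eq_sub_of_hasDerivAt_of_le hab hc hd
      ((intervalIntegrable_iff_integrableOn_Ioc_of_le hab).2 hint)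
  have hnn : 0 ≤ᵐ[volume.restrict (Ioo a b)] f :=
    (ae_restrict_iff' measurableSet_Ioo).2 (Filter.Eventually.of_forall hf)
  rw [integral_of_le hab, ← restrict_Ioo_eq_restrict_Ioc] at h1
  refine ⟨sub_nonneg.1 (h1 ▸ integral_nonneg_of_ae hnn), ?_⟩
  rw [← restrict_Ioo_eq_restrict_Ioc, setLIntegral_congr_fun measurableSet_Ioo hg, ← h1,
    ofReal_integral_eq_lintegral_ofReal (hint.mono_set Ioo_subset_Ioc_self) hnn]

/-- The primitive of `exp (t ^ 2)` vanishing at `0`. -/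
noncomputable def expSqInt (y : ℝ) : ℝ := ∫ t in (0 : ℝ)..y, exp (t ^ 2)

/-- The primitive of `exp (-t ^ 2)` vanishing at `0`. -/
noncomputable def gaussInt (y : ℝ) : ℝ := ∫ t in (0 : ℝ)..y, exp (-t ^ 2)

theorem hasDerivAt_expSqInt (y : ℝ) : HasDerivAt expSqInt (exp (y ^ 2)) y :=
  integral_hasDerivAt_right (Continuous.intervalIntegrable (by fun_prop) _ _)
    (Continuous.stronglyMeasurableAtFilter (by fun_prop) _ _)
    (Continuous.continuousAt (by fun_prop))

theorem hasDerivAt_gaussInt (y : ℝ) : HasDerivAt gaussInt (exp (-y ^ 2)) y :=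
  integral_hasDerivAt_right (Continuous.intervalIntegrable (by fun_prop) _ _)
    (Continuous.stronglyMeasurableAtFilter (by fun_prop) _ _)
    (Continuous.continuousAt (by fun_prop))

@[fun_prop]
theorem continuous_expSqInt : Continuous expSqInt :=
  continuous_iff_continuousAt.2 fun y => (hasDerivAt_expSqInt y).continuousAt

@[fun_prop]
theorem continuous_gaussInt : Continuous gaussInt :=
  continuous_iff_continuousAt.2 fun y => (hasDerivAt_gaussInt y).continuousAt

@[simp] theorem expSqInt_zero : expSqInt 0 = 0 := integral_same

@[simp] theorem gaussInt_zero : gaussInt 0 = 0 := integral_same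

theorem expSqInt_nonneg {y : ℝ} (hy : 0 ≤ y) : 0 ≤ expSqInt y :=
  integral_nonneg hy fun _ _ => (exp_pos _).le

theorem gaussInt_nonneg {y : ℝ} (hy : 0 ≤ y) : 0 ≤ gaussInt y :=
  integral_nonneg hy fun _ _ => (exp_pos _).le

theorem gaussInt_mono {x y : ℝ} (h : x ≤ y) : gaussInt x ≤ gaussInt y :=
  monotone_of_deriv_nonneg (fun z => (hasDerivAt_gaussInt z).differentiableAt)
    (fun z => (hasDerivAt_gaussInt z).deriv ▸ (exp_pos _).le) h

theorem hasDerivAt_expSqInt_sqrt {u : ℝ} (hu : 0 < u) :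
    HasDerivAt (fun u => expSqInt √u) (exp u * (1 / (2 * √u))) u := by
  have h := (hasDerivAt_expSqInt √u).comp u (hasDerivAt_sqrt hu.ne')
  rwa [sq_sqrt hu.le] at h

theorem hasDerivAt_gaussInt_sqrt {u : ℝ} (hu : 0 < u) :
    HasDerivAt (fun u => gaussInt √u) (exp (-u) * (1 / (2 * √u))) u := by
  have h := (hasDerivAt_gaussInt √u).comp u (hasDerivAt_sqrt hu.ne')
  rwa [sq_sqrt hu.le] at h

/-- The exponential kernel `exp (-|x|)`. -/
noncomputable def expKer (x : ℝ) : ENNReal := ENNReal.ofReal (exp (-|x|))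

/-- The power kernel `|x| ^ (-1/2)`. -/
noncomputable def powKer (x : ℝ) : ENNReal := ENNReal.ofReal (√|x|)⁻¹

@[fun_prop]
theorem measurable_expKer : Measurable expKer := by unfold expKer; fun_prop

@[fun_prop]
theorem measurable_powKer : Measurable powKer := by unfold powKer; fun_prop

theorem expKer_neg (x : ℝ) : expKer (-x) = expKer x := by simp [expKer]

theorem powKer_neg (x : ℝ) : powKer (-x) = powKer x := by simp [powKer]

theorem expKer_sub_comm (x y : ℝ) : expKer (x - y) = expKer (y - x) := by
  rw [← expKer_neg, neg_sub]

theorem powKer_sub_comm (x y : ℝ) : powKer (x - y) = powKer (y - x) := by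
  rw [← powKer_neg, neg_sub]

theorem expKer_of_nonneg {x : ℝ} (hx : 0 ≤ x) : expKer x = ENNReal.ofReal (exp (-x)) := by
  rw [expKer, abs_of_nonneg hx]

theorem powKer_of_nonneg {x : ℝ} (hx : 0 ≤ x) : powKer x = ENNReal.ofReal (√x)⁻¹ := by
  rw [powKer, abs_of_nonneg hx]

theorem expKer_mul_powKer {x y : ℝ} (hx : 0 ≤ x) (hy : 0 ≤ y) :
    expKer x * powKer y = ENNReal.ofReal (exp (-x) * (√y)⁻¹) := by
  rw [expKer_of_nonneg hx, powKer_of_nonneg hy, ← ENNReal.ofReal_mul (exp_pos _).le]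

/-- The half-order fractional integral of `exp (-·)`, up to the factor `√π`. -/
noncomputable def halfConv (u : ℝ) : ℝ := 2 * exp (-u) * expSqInt √u

theorem halfConv_nonneg (u : ℝ) : 0 ≤ halfConv u :=
  mul_nonneg (by positivity) (expSqInt_nonneg (sqrt_nonneg u))

@[fun_prop]
theorem continuous_halfConv : Continuous halfConv := by unfold halfConv; fun_prop

@[simp] theorem halfConv_zero : halfConv 0 = 0 := by simp [halfConv]

theorem hasDerivAt_halfConv {u : ℝ} (hu : 0 < u) :
    HasDerivAt halfConv (1 / √u - halfConv u) u := by
  have h := (((hasDerivAt_neg u).exp).const_mul 2).mul (hasDerivAt_expSqInt_sqrt hu)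
  refine h.congr_deriv ?_
  have h2 : exp (-u) * exp u = 1 := by rw [← exp_add]; simp
  have h3 : √u ≠ 0 := (sqrt_pos.2 hu).ne'
  unfold halfConv
  field_simp
  linear_combination h2

theorem hasDerivAt_expSqInt_sqrt_sub {s x : ℝ} (h : x < s) :
    HasDerivAt (fun x => expSqInt √(s - x)) (-(exp (s - x) * (1 / (2 * √(s - x))))) x := by
  exact ((hasDerivAt_expSqInt_sqrt (sub_pos.2 h)).comp x
    ((hasDerivAt_id x).const_sub s)).congr_deriv (by ring)

theorem hasDerivAt_gaussInt_sqrt_sub {s x : ℝ} (h : x < s) :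
    HasDerivAt (fun x => gaussInt √(s - x)) (-(exp (-(s - x)) * (1 / (2 * √(s - x))))) x := by
  exact ((hasDerivAt_gaussInt_sqrt (sub_pos.2 h)).comp x
    ((hasDerivAt_id x).const_sub s)).congr_deriv (by ring)

theorem lintegral_expKer_mul_powKer_sub {u : ℝ} (hu : 0 ≤ u) :
    ∫⁻ a in Ioc 0 u, expKer a * powKer (a - u) = ENNReal.ofReal (halfConv u) := by
  have h := (lintegral_Ioc_eq_of_hasDerivAt (F := fun a => -2 * exp (-u) * expSqInt √(u - a))
    (f := fun a => exp (-a) * (√(u - a))⁻¹) (g := fun a => expKer a * powKer (a - u)) hu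
    (by fun_prop) (fun x hx => ?_) (fun x hx => by positivity) (fun x hx => ?_)).2
  · rw [h]; congr 1; simp [halfConv]
  · refine ((hasDerivAt_expSqInt_sqrt_sub hx.2).const_mul (-2 * exp (-u))).congr_deriv ?_
    have h2 : exp (-u) * exp (u - x) = exp (-x) := by rw [← exp_add]; ring_nf
    have h3 : √(u - x) ≠ 0 := (sqrt_pos.2 (sub_pos.2 hx.2)).ne'
    rw [← h2]
    field_simp
  · rw [powKer_sub_comm, expKer_mul_powKer hx.1.le (sub_nonneg.2 hx.2.le)]

theorem lintegral_expKer_sub_mul_powKer {u : ℝ} (hu : 0 ≤ u) :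
    ∫⁻ b in Ioc 0 u, expKer (b - u) * powKer b = ENNReal.ofReal (halfConv u) := by
  have h := (lintegral_Ioc_eq_of_hasDerivAt (F := fun b => 2 * exp (-u) * expSqInt √b)
    (f := fun b => exp (-(u - b)) * (√b)⁻¹) (g := fun b => expKer (b - u) * powKer b) hu
    (by fun_prop) (fun x hx => ?_) (fun x hx => by positivity) (fun x hx => ?_)).2
  · rw [h]; congr 1; simp [halfConv]
  · refine ((hasDerivAt_expSqInt_sqrt hx.1).const_mul (2 * exp (-u))).congr_deriv ?_
    have h2 : exp (-u) * exp x = exp (-(u - x)) := by rw [← exp_add]; ring_nf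
    have h3 : √x ≠ 0 := (sqrt_pos.2 hx.1).ne'
    rw [← h2]
    field_simp
  · rw [expKer_sub_comm, expKer_mul_powKer (sub_nonneg.2 hx.2.le) hx.1.le]

/-- The integral over `c ∈ (0, a]` of `exp (-(s - c)) * (r - c) ^ (-1/2)`. -/
theorem lintegral_expKer_sub_mul_powKer_sub {a r s : ℝ} (ha : 0 ≤ a) (hr : a ≤ r) (hs : a ≤ s) :
    ∫⁻ c in Ioc 0 a, expKer (s - c) * powKer (r - c)
      = ENNReal.ofReal (2 * exp (r - s) * (gaussInt √r - gaussInt √(r - a))) := by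
  have h := (lintegral_Ioc_eq_of_hasDerivAt (F := fun c => -2 * exp (r - s) * gaussInt √(r - c))
    (f := fun c => exp (-(s - c)) * (√(r - c))⁻¹) (g := fun c => expKer (s - c) * powKer (r - c))
    ha (by fun_prop) (fun x hx => ?_) (fun x hx => by positivity) (fun x hx => ?_)).2
  · rw [h]; congr 1; simp; ring
  · have hxr : x < r := hx.2.trans_le hr
    refine ((hasDerivAt_gaussInt_sqrt_sub hxr).const_mul (-2 * exp (r - s))).congr_deriv ?_
    have h2 : exp (r - s) * exp (-(r - x)) = exp (-(s - x)) := by rw [← exp_add]; ring_nf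
    have h3 : √(r - x) ≠ 0 := (sqrt_pos.2 (sub_pos.2 hxr)).ne'
    rw [← h2]
    field_simp
  · rw [expKer_mul_powKer (sub_nonneg.2 (hx.2.le.trans hs)) (sub_nonneg.2 (hx.2.le.trans hr))]

theorem lintegral_expKer {u : ℝ} (hu : 0 ≤ u) :
    ∫⁻ t in Ioc 0 u, expKer t = ENNReal.ofReal (1 - exp (-u)) := by
  have h := (lintegral_Ioc_eq_of_hasDerivAt (F := fun t => -exp (-t))
    (f := fun t => exp (-t)) (g := expKer) hu
    (by fun_prop) (fun x hx => ?_) (fun x hx => by positivity) (fun x hx => ?_)).2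
  · rw [h]; congr 1; simp; ring
  · exact ((hasDerivAt_neg x).exp).neg.congr_deriv (by ring)
  · exact expKer_of_nonneg hx.1.le

/-- The Beta integral `B(1/2, 1/2) = π`. -/
theorem lintegral_powKer_mul_powKer {t u : ℝ} (h : t < u) :
    ∫⁻ m in Ioc t u, powKer (m - t) * powKer (u - m) = ENNReal.ofReal π := by
  have hut : 0 < u - t := sub_pos.2 h
  have h := (lintegral_Ioc_eq_of_hasDerivAt (F := fun m => arcsin ((2 * m - t - u) / (u - t)))
    (f := fun m => (√(m - t))⁻¹ * (√(u - m))⁻¹) (g := fun m => powKer (m - t) * powKer (u - m))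
    h.le (by fun_prop) (fun x hx => ?_) (fun x hx => by positivity) (fun x hx => ?_)).2
  · rw [h]
    have h1 : (2 * u - t - u) / (u - t) = 1 := by field_simp; ring
    have h2 : (2 * t - t - u) / (u - t) = -1 := by field_simp; ring
    simp only [h1, h2, arcsin_one, arcsin_neg_one]
    congr 1; ring
  · have hx1 : 0 < x - t := sub_pos.2 hx.1
    have hx2 : 0 < u - x := sub_pos.2 hx.2
    have hlt : -1 < (2 * x - t - u) / (u - t) := by rw [lt_div_iff₀ hut]; linarith
    have hgt : (2 * x - t - u) / (u - t) < 1 := by rw [div_lt_iff₀ hut]; linarith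
    have hlin : HasDerivAt (fun m : ℝ => (2 * m - t - u) / (u - t)) (2 / (u - t)) x := by
      simpa using ((((hasDerivAt_id x).const_mul 2).sub_const t).sub_const u).div_const (u - t)
    refine ((hasDerivAt_arcsin hlt.ne' hgt.ne).comp x hlin).congr_deriv ?_
    have h4 : 1 - ((2 * x - t - u) / (u - t)) ^ 2 = (2 / (u - t)) ^ 2 * ((x - t) * (u - x)) := by
      field_simp; ring
    rw [h4, sqrt_mul (by positivity), sqrt_sq (by positivity), sqrt_mul hx1.le]
    have := (sqrt_pos.2 hx1).ne'
    have := (sqrt_pos.2 hx2).ne'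
    field_simp
  · rw [powKer_of_nonneg (sub_nonneg.2 hx.1.le), powKer_of_nonneg (sub_nonneg.2 hx.2.le),
      ENNReal.ofReal_mul (by positivity)]
end

section
open Set

theorem lintegral_expKer_sub_mul_powKer_mul_powKer {u : ℝ} (hu : 0 ≤ u) :
    ∫⁻ m in Ioc 0 u, ENNReal.ofReal (halfConv m) * powKer (u - m)
      = ENNReal.ofReal (π * (1 - exp (-u))) := by
  calc _ = ∫⁻ m in Ioc 0 u, ∫⁻ t in Ioc 0 m, expKer t * (powKer (m - t) * powKer (u - m)) := by
        refine setLIntegral_congr_fun measurableSet_Ioc fun m hm => ?_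
        rw [← lintegral_expKer_mul_powKer_sub hm.1.le, ← lintegral_mul_const _ (by fun_prop)]
        refine lintegral_congr fun t => ?_
        rw [powKer_sub_comm t m, mul_assoc]
    _ = ∫⁻ t in Ioc 0 u, ∫⁻ m in Ioc t u, expKer t * (powKer (m - t) * powKer (u - m)) :=
        lintegral_Ioc_triangle_swap
          (f := fun t m => expKer t * (powKer (m - t) * powKer (u - m))) (by fun_prop) u
    _ = ∫⁻ t in Ioo 0 u, expKer t * ENNReal.ofReal π := by
        rw [← restrict_Ioo_eq_restrict_Ioc]
        refine setLIntegral_congr_fun measurableSet_Ioo fun t ht => ?_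
        rw [lintegral_const_mul _ (by fun_prop), lintegral_powKer_mul_powKer ht.2]
    _ = _ := by
        rw [restrict_Ioo_eq_restrict_Ioc, lintegral_mul_const _ (by fun_prop), lintegral_expKer hu,
          mul_comm, ENNReal.ofReal_mul pi_pos.le]

theorem lintegral_expKer_mul_powKer_mul_gaussInt {u : ℝ} (hu : 0 ≤ u) :
    ∫⁻ m in Ioc 0 u, expKer m * powKer m * ENNReal.ofReal (2 * gaussInt √(u - m))
      = ENNReal.ofReal (π * (1 - exp (-u))) := by
  have hin : ∀ m ∈ Ioc 0 u, ENNReal.ofReal (2 * gaussInt √(u - m))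
      = ∫⁻ c in Ioc m u, expKer (c - m) * powKer (c - m) := by
    intro m hm
    have h := (lintegral_Ioc_eq_of_hasDerivAt (F := fun c => 2 * gaussInt √(c - m))
      (f := fun c => exp (-(c - m)) * (√(c - m))⁻¹)
      (g := fun c => expKer (c - m) * powKer (c - m))
      hm.2 (by fun_prop) (fun x hx => ?_) (fun x hx => by positivity) (fun x hx => ?_)).2
    · rw [h]; simp
    · have h1 := (hasDerivAt_gaussInt_sqrt (sub_pos.2 hx.1)).comp x ((hasDerivAt_id x).sub_const m)
      refine (h1.const_mul 2).congr_deriv ?_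
      have h3 : √(x - m) ≠ 0 := (sqrt_pos.2 (sub_pos.2 hx.1)).ne'
      field_simp
    · exact expKer_mul_powKer (sub_nonneg.2 hx.1.le) (sub_nonneg.2 hx.1.le)
  calc _ = ∫⁻ m in Ioc 0 u, ∫⁻ c in Ioc m u,
          expKer m * powKer m * (expKer (c - m) * powKer (c - m)) := by
        refine setLIntegral_congr_fun measurableSet_Ioc fun m hm => ?_
        rw [hin m hm, lintegral_const_mul _ (by fun_prop)]
    _ = ∫⁻ c in Ioc 0 u, ∫⁻ m in Ioc 0 c,
          expKer m * powKer m * (expKer (c - m) * powKer (c - m)) :=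
        (lintegral_Ioc_triangle_swap
          (f := fun m c => expKer m * powKer m * (expKer (c - m) * powKer (c - m)))
          (by fun_prop) u).symm
    _ = ∫⁻ c in Ioc 0 u, expKer c * ENNReal.ofReal π := by
        refine setLIntegral_congr_fun measurableSet_Ioc fun c hc => ?_
        rw [← lintegral_powKer_mul_powKer hc.1, ← lintegral_const_mul _ (by fun_prop)]
        refine setLIntegral_congr_fun measurableSet_Ioc fun m hm => ?_
        rw [expKer_of_nonneg hm.1.le, expKer_of_nonneg (sub_nonneg.2 hm.2),
          expKer_of_nonneg hc.1.le, show -c = -m + -(c - m) by ring, exp_add,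
          ENNReal.ofReal_mul (exp_pos _).le, sub_zero]
        ring
    _ = _ := by
        rw [lintegral_mul_const _ (by fun_prop), lintegral_expKer hu, mul_comm,
          ENNReal.ofReal_mul pi_pos.le]

theorem lintegral_expKer_mul_powKer_mul_gaussInt_sub {u : ℝ} (hu : 0 ≤ u) :
    π * (1 - exp (-u)) ≤ 4 * gaussInt √u ^ 2 ∧
    ∫⁻ m in Ioc 0 u, expKer m * powKer m * ENNReal.ofReal (2 * (gaussInt √u - gaussInt √(u - m)))
      = ENNReal.ofReal (4 * gaussInt √u ^ 2 - π * (1 - exp (-u))) := by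
  have hnn : 0 ≤ π * (1 - exp (-u)) :=
    mul_nonneg pi_pos.le (sub_nonneg.2 (exp_le_one_iff.2 (by linarith)))
  have hsum : (∫⁻ m in Ioc 0 u,
      expKer m * powKer m * ENNReal.ofReal (2 * (gaussInt √u - gaussInt √(u - m))))
        + ENNReal.ofReal (π * (1 - exp (-u))) = ENNReal.ofReal (4 * gaussInt √u ^ 2) := by
    rw [← lintegral_expKer_mul_powKer_mul_gaussInt hu, ← lintegral_add_left (by fun_prop)]
    have h1 : ∫⁻ m in Ioc 0 u, expKer m * powKer m = ENNReal.ofReal (2 * gaussInt √u) := by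
      have h := (lintegral_Ioc_eq_of_hasDerivAt (F := fun c => 2 * gaussInt √c)
        (f := fun c => exp (-c) * (√c)⁻¹) (g := fun c => expKer c * powKer c)
        hu (by fun_prop) (fun x hx => ?_) (fun x hx => by positivity) (fun x hx => ?_)).2
      · rw [h]; simp
      · refine ((hasDerivAt_gaussInt_sqrt hx.1).const_mul 2).congr_deriv ?_
        have h3 : √x ≠ 0 := (sqrt_pos.2 hx.1).ne'
        field_simp
      · exact expKer_mul_powKer hx.1.le hx.1.le
    calc _ = ∫⁻ m in Ioc 0 u, expKer m * powKer m * ENNReal.ofReal (2 * gaussInt √u) := by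
          refine setLIntegral_congr_fun measurableSet_Ioc fun m hm => ?_
          have h2 : gaussInt √(u - m) ≤ gaussInt √u :=
            gaussInt_mono (sqrt_le_sqrt (by linarith [hm.1]))
          rw [← mul_add, ← ENNReal.ofReal_add (by linarith)
            (mul_nonneg two_pos.le (gaussInt_nonneg (sqrt_nonneg _)))]
          congr 2; ring
      _ = _ := by
          rw [lintegral_mul_const _ (by fun_prop), h1, ← ENNReal.ofReal_mul
            (mul_nonneg two_pos.le (gaussInt_nonneg (sqrt_nonneg _)))]
          congr 1; ring
  constructor
  · refine (ENNReal.ofReal_le_ofReal_iff (by positivity)).1 ?_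
    rw [← hsum]; exact le_add_self
  · rw [ENNReal.ofReal_sub _ hnn, ← hsum, ENNReal.add_sub_cancel_right ENNReal.ofReal_ne_top]

/-- Contribution of the configurations whose extreme points are joined by the exponential kernel. -/
theorem lintegral_face_expKer {u : ℝ} (hu : 0 ≤ u) :
    0 ≤ 4 * gaussInt √u ^ 2 - π * (1 - exp (-u)) ^ 2 ∧
    ∫⁻ d in Ioc 0 u, ∫⁻ b in Ioc 0 u, expKer u * expKer (b - d) * powKer b * powKer (u - d)
      = ENNReal.ofReal (4 * gaussInt √u ^ 2 - π * (1 - exp (-u)) ^ 2) := by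
  obtain ⟨hle, hW⟩ := lintegral_expKer_mul_powKer_mul_gaussInt_sub hu
  have hnn : 0 ≤ π * (1 - exp (-u)) :=
    mul_nonneg pi_pos.le (sub_nonneg.2 (exp_le_one_iff.2 (by linarith)))
  have hid : 4 * gaussInt √u ^ 2 - π * (1 - exp (-u)) ^ 2
      = exp (-u) * (π * (1 - exp (-u))) + (4 * gaussInt √u ^ 2 - π * (1 - exp (-u))) := by ring
  refine ⟨hid ▸ add_nonneg (by positivity) (sub_nonneg.2 hle), ?_⟩
  rw [lintegral_Ioc_square_split
    (f := fun d b => expKer u * expKer (b - d) * powKer b * powKer (u - d)) (by fun_prop)]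
  rw [hid, ENNReal.ofReal_add (by positivity) (sub_nonneg.2 hle),
    ENNReal.ofReal_mul (exp_pos _).le, ← hW, ← lintegral_expKer_sub_mul_powKer_mul_powKer hu,
    ← lintegral_const_mul _ (by unfold halfConv; fun_prop),
    ← lintegral_add_left (by unfold halfConv; fun_prop)]
  refine setLIntegral_congr_fun measurableSet_Ioc fun m hm => ?_
  rw [lintegral_add_left (by fun_prop)]
  congr 1
  · rw [← lintegral_expKer_sub_mul_powKer hm.1.le, ← expKer_of_nonneg hu,
      ← lintegral_mul_const _ (by fun_prop), ← lintegral_const_mul _ (by fun_prop)]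
    refine lintegral_congr fun b => ?_
    ring
  · have h := lintegral_expKer_sub_mul_powKer_sub hm.1.le hm.2 le_rfl
    calc _ = ∫⁻ d in Ioc 0 m, (expKer u * powKer m) * (expKer (m - d) * powKer (u - d)) :=
          lintegral_congr fun d => by ring
      _ = _ := by
          have h2 : gaussInt √(u - m) ≤ gaussInt √u :=
            gaussInt_mono (sqrt_le_sqrt (by linarith [hm.1]))
          rw [lintegral_const_mul _ (by fun_prop), h,
            show 2 * exp (u - m) * (gaussInt √u - gaussInt √(u - m))
              = exp (u - m) * (2 * (gaussInt √u - gaussInt √(u - m))) by ring,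
            ENNReal.ofReal_mul (exp_pos _).le, expKer_of_nonneg hu, expKer_of_nonneg hm.1.le,
            show -m = -u + (u - m) by ring, exp_add, ENNReal.ofReal_mul (exp_pos _).le]
          ring

/-- Contribution of the configurations whose extreme points are joined by the power kernel. -/
theorem lintegral_face_powKer {u : ℝ} (hu : 0 < u) :
    0 ≤ √u * halfConv u - 1 + halfConv u / (2 * √u)
      + exp (-u) * (2 * √u * gaussInt √u - gaussInt √u / √u + exp (-u)) ∧
    ∫⁻ d in Ioc 0 u, ∫⁻ c in Ioc 0 u, expKer c * expKer (u - d) * powKer u * powKer (c - d)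
      = ENNReal.ofReal (√u * halfConv u - 1 + halfConv u / (2 * √u)
        + exp (-u) * (2 * √u * gaussInt √u - gaussInt √u / √u + exp (-u))) := by
  have hFTC := lintegral_Ioc_eq_of_hasDerivAt
    (F := fun m => exp (-u) * (2 * m * expSqInt √m - √m * exp m + expSqInt √m
      + 2 * m * gaussInt √m - gaussInt √m + √m * exp (-m)))
    (f := fun m => exp (-u) * (2 * expSqInt √m + 2 * gaussInt √m))
    (g := fun m => ENNReal.ofReal (exp (-u) * (2 * expSqInt √m + 2 * gaussInt √m))) hu.le
    (by fun_prop) (fun x hx => ?_) (fun x hx => mul_nonneg (exp_pos _).le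
      (add_nonneg (mul_nonneg two_pos.le (expSqInt_nonneg (sqrt_nonneg _)))
        (mul_nonneg two_pos.le (gaussInt_nonneg (sqrt_nonneg _))))) (fun x hx => rfl)
  · have hsq : √u * √u = u := mul_self_sqrt hu.le
    have hs : √u ≠ 0 := (sqrt_pos.2 hu).ne'
    have he : exp (-u) * exp u = 1 := by rw [← exp_add]; simp
    have hid : √u * halfConv u - 1 + halfConv u / (2 * √u)
        + exp (-u) * (2 * √u * gaussInt √u - gaussInt √u / √u + exp (-u))
        = (√u)⁻¹ * (exp (-u) * (2 * u * expSqInt √u - √u * exp u + expSqInt √u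
      + 2 * u * gaussInt √u - gaussInt √u + √u * exp (-u))
      - exp (-u) * (2 * 0 * expSqInt √0 - √0 * exp 0 + expSqInt √0
      + 2 * 0 * gaussInt √0 - gaussInt √0 + √0 * exp (-0))) := by
      simp only [sqrt_zero, expSqInt_zero, gaussInt_zero, halfConv]
      field_simp
      rw [sq, hsq]
      linear_combination √u * he + 2 * exp (-u) * expSqInt √u * hsq
    rw [hid]
    refine ⟨mul_nonneg (by positivity) (sub_nonneg.2 hFTC.1), ?_⟩
    rw [ENNReal.ofReal_mul (by positivity), ← hFTC.2, ← powKer_of_nonneg hu.le,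
      lintegral_Ioc_square_split
        (f := fun d c => expKer c * expKer (u - d) * powKer u * powKer (c - d)) (by fun_prop),
      ← lintegral_const_mul _ (by fun_prop)]
    refine setLIntegral_congr_fun measurableSet_Ioc fun m hm => ?_
    have h1 : exp (-u) * (2 * expSqInt √m + 2 * gaussInt √m)
        = exp (-(u - m)) * halfConv m + exp (-m) * (2 * exp (m - u) * gaussInt √m) := by
      have h2 : exp (-(u - m)) = exp (-u) * exp m := by rw [← exp_add]; ring_nf
      have h3 : exp (m - u) = exp (-u) * exp m := by rw [← exp_add]; ring_nf
      have h4 : exp m * exp (-m) = 1 := by rw [← exp_add]; simp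
      rw [h2, h3, halfConv]
      linear_combination (-(2 * exp (-u) * (expSqInt √m + gaussInt √m))) * h4
    have hpos := gaussInt_nonneg (sqrt_nonneg m)
    rw [h1, ENNReal.ofReal_add (mul_nonneg (exp_pos _).le (halfConv_nonneg _)) (by positivity),
      ENNReal.ofReal_mul (exp_pos _).le, ENNReal.ofReal_mul (exp_pos _).le,
      ← expKer_of_nonneg (sub_nonneg.2 hm.2), ← expKer_of_nonneg hm.1.le,
      ← lintegral_expKer_mul_powKer_sub hm.1.le]
    have h5 := lintegral_expKer_sub_mul_powKer_sub hm.1.le le_rfl hm.2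
    rw [sub_self, sqrt_zero, gaussInt_zero, sub_zero] at h5
    rw [← h5, lintegral_add_left (by fun_prop), mul_add, ← lintegral_const_mul _ (by fun_prop),
      ← lintegral_const_mul _ (by fun_prop), ← lintegral_const_mul _ (by fun_prop),
      ← lintegral_const_mul _ (by fun_prop)]
    congr 1
    · exact lintegral_congr fun c => by ring
    · exact lintegral_congr fun d => by ring
  · have hx0 := hx.1
    have hsq : √x * √x = x := mul_self_sqrt hx0.le
    have hs : √x ≠ 0 := (sqrt_pos.2 hx0).ne'
    have hE := hasDerivAt_expSqInt_sqrt hx0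
    have hR := hasDerivAt_gaussInt_sqrt hx0
    have h2m := (hasDerivAt_id x).const_mul 2
    have hroot := hasDerivAt_sqrt hx0.ne'
    refine (((((((h2m.mul hE).sub (hroot.mul (hasDerivAt_exp x))).add hE).add
      (h2m.mul hR)).sub hR).add
      (hroot.mul ((hasDerivAt_neg x).exp))).const_mul (exp (-u))).congr_deriv ?_
    simp only [id]
    field_simp
    simp only [sq, hsq]
    ring

/-- Contribution of the configurations whose extreme points are not joined by a kernel. -/
theorem lintegral_face_diag {u : ℝ} (hu : 0 ≤ u) :
    ∫⁻ b in Ioc 0 u, ∫⁻ c in Ioc 0 u, expKer c * expKer (b - u) * powKer b * powKer (c - u)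
      = ENNReal.ofReal (halfConv u ^ 2) := by
  have h : ∀ b, ∫⁻ c in Ioc 0 u, expKer c * expKer (b - u) * powKer b * powKer (c - u)
      = (expKer (b - u) * powKer b) * ENNReal.ofReal (halfConv u) := by
    intro b
    rw [← lintegral_expKer_mul_powKer_sub hu, ← lintegral_const_mul _ (by fun_prop)]
    exact lintegral_congr fun c => by ring
  simp_rw [h]
  rw [lintegral_mul_const _ (by fun_prop), lintegral_expKer_sub_mul_powKer hu, sq,
    ENNReal.ofReal_mul (halfConv_nonneg u)]
end

section
open Set

theorem lintegral_Ioc_reflect (f : ℝ → ENNReal) (m : ℝ) :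
    ∫⁻ x in Ioc 0 m, f (m - x) = ∫⁻ x in Ioc 0 m, f x := by
  have h := (Measure.measurePreserving_sub_left (volume : Measure ℝ) m).setLIntegral_comp_preimage_emb
    (MeasurableEquiv.subLeft m).measurableEmbedding f (Ioo 0 m)
  rw [preimage_const_sub_Ioo, sub_zero, sub_self] at h
  rwa [← restrict_Ioo_eq_restrict_Ioc]

/-- The iterated primitive of `4 * exp (-z ^ 2) * expSqInt z`. -/
noncomputable def dawsonInt (y : ℝ) : ℝ := ∫ z in (0 : ℝ)..y, 4 * exp (-z ^ 2) * expSqInt z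

theorem hasDerivAt_dawsonInt (y : ℝ) :
    HasDerivAt dawsonInt (4 * exp (-y ^ 2) * expSqInt y) y :=
  integral_hasDerivAt_right (Continuous.intervalIntegrable (by fun_prop) _ _)
    (Continuous.stronglyMeasurableAtFilter (by fun_prop) _ _)
    (Continuous.continuousAt (by fun_prop))

@[fun_prop]
theorem continuous_dawsonInt : Continuous dawsonInt :=
  continuous_iff_continuousAt.2 fun y => (hasDerivAt_dawsonInt y).continuousAt

@[simp] theorem dawsonInt_zero : dawsonInt 0 = 0 := integral_same

theorem hasDerivAt_dawsonInt_sqrt {u : ℝ} (hu : 0 < u) :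
    HasDerivAt (fun u => dawsonInt √u) (halfConv u / √u) u := by
  have h := (hasDerivAt_dawsonInt √u).comp u (hasDerivAt_sqrt hu.ne')
  refine h.congr_deriv ?_
  have hs : √u ≠ 0 := (sqrt_pos.2 hu).ne'
  rw [sq_sqrt hu.le, halfConv]
  field_simp
  ring

/-- The integral of `exp (-|a|) * exp (-|c - b|) * |b| ^ (-1/2) * |a - c| ^ (-1/2)` over the cube
of side `v`. -/
noncomputable def cubeIntegral (v : ℝ) : ℝ :=
  2 * dawsonInt √v - √v * halfConv v - halfConv v ^ 2 / 2 + 2 * √v * exp (-v) * gaussInt √v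
    + (4 * v - 2) * gaussInt √v ^ 2
    - π * (v - 3 / 2 + 2 * exp (-v) - exp (-v) ^ 2 / 2)

/-- One quarter of the four-dimensional integral, in closed form. -/
noncomputable def tesseractIntegral (u : ℝ) : ℝ :=
  2 * u * dawsonInt √u - 3 * u + 3 * √u * halfConv u - 2 * dawsonInt √u + halfConv u ^ 2 / 4
    - √u * exp (-u) * gaussInt √u + gaussInt √u ^ 2 / 2 + 2 * u * (√u * exp (-u) * gaussInt √u)
    + u * exp (-u) ^ 2 / 2 + (2 * u ^ 2 - 2 * u) * gaussInt √u ^ 2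
    - π * (u ^ 2 / 2 - 3 * u / 2 - 2 * exp (-u) + exp (-u) ^ 2 / 4) - 7 * π / 4

theorem lintegral_faces {v : ℝ} (hv : 0 ≤ v) :
    0 ≤ cubeIntegral v ∧
    ∫⁻ d in Ioc 0 v, ∫⁻ b in Ioc 0 v, ∫⁻ c in Ioc 0 v,
        expKer c * expKer (b - d) * powKer b * powKer (c - d)
      = ENNReal.ofReal (cubeIntegral v) := by
  have h := lintegral_Ioc_eq_of_hasDerivAt (F := cubeIntegral)
    (f := fun u => halfConv u ^ 2 + (√u * halfConv u - 1 + halfConv u / (2 * √u)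
      + exp (-u) * (2 * √u * gaussInt √u - gaussInt √u / √u + exp (-u)))
      + (4 * gaussInt √u ^ 2 - π * (1 - exp (-u)) ^ 2))
    (g := fun u => (∫⁻ b in Ioc 0 u, ∫⁻ c in Ioc 0 u,
        expKer c * expKer (b - u) * powKer b * powKer (c - u))
      + (∫⁻ d in Ioc 0 u, ∫⁻ c in Ioc 0 u, expKer c * expKer (u - d) * powKer u * powKer (c - d))
      + ∫⁻ d in Ioc 0 u, ∫⁻ b in Ioc 0 u, expKer u * expKer (b - d) * powKer b * powKer (u - d))
    hv (by unfold cubeIntegral; fun_prop) (fun x hx => ?_) (fun x hx => ?_) (fun x hx => ?_)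
  · rw [lintegral_Ioc_cube_split
      (f := fun d b c => expKer c * expKer (b - d) * powKer b * powKer (c - d)) (by fun_prop), h.2]
    have h0 : cubeIntegral 0 = 0 := by simp [cubeIntegral]; norm_num
    rw [h0, sub_zero]
    exact ⟨h0 ▸ h.1, rfl⟩
  · have hx0 := hx.1
    have hsq : √x * √x = x := mul_self_sqrt hx0.le
    have hs : √x ≠ 0 := (sqrt_pos.2 hx0).ne'
    have hK := hasDerivAt_halfConv hx0
    have hR := hasDerivAt_gaussInt_sqrt hx0
    have hJ := hasDerivAt_dawsonInt_sqrt hx0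
    have hroot := hasDerivAt_sqrt hx0.ne'
    have he := (hasDerivAt_neg x).exp
    have hlin : HasDerivAt (fun v : ℝ => 4 * v - 2) (4 * 1) x :=
      ((hasDerivAt_id x).const_mul 4).sub_const 2
    refine ((((((hJ.const_mul 2).sub (hroot.mul hK)).sub ((hK.pow 2).div_const 2)).add
      (((hroot.const_mul 2).mul he).mul hR)).add (hlin.mul (hR.pow 2))).sub
      (((((hasDerivAt_id x).sub_const (3 / 2)).add (he.const_mul 2)).sub
        ((he.pow 2).div_const 2)).const_mul π)).congr_deriv ?_
    dsimp
    generalize √x = s at *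
    subst hsq
    generalize halfConv (s * s) = K
    generalize exp (-(s * s)) = e
    field_simp
    ring
  · exact add_nonneg (add_nonneg (sq_nonneg _) (lintegral_face_powKer hx.1).1)
      (lintegral_face_expKer hx.1.le).1
  · have h1 := lintegral_face_powKer hx.1
    have h2 := lintegral_face_expKer hx.1.le
    rw [ENNReal.ofReal_add (add_nonneg (sq_nonneg _) h1.1) h2.1,
      ENNReal.ofReal_add (sq_nonneg _) h1.1, lintegral_face_diag hx.1.le, h1.2, h2.2]

theorem lintegral_tesseract {T : ℝ} (hT : 0 ≤ T) :
    0 ≤ tesseractIntegral T ∧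
    ∫⁻ a in Ioc 0 T, ∫⁻ b in Ioc 0 T, ∫⁻ c in Ioc 0 T, ∫⁻ d in Ioc 0 T,
        expKer (a - c) * expKer (b - d) * powKer (b - a) * powKer (c - d)
      = 4 * ENNReal.ofReal (tesseractIntegral T) := by
  have h := lintegral_Ioc_eq_of_hasDerivAt (F := tesseractIntegral) (f := cubeIntegral)
    (g := fun m => ∫⁻ d in Ioc 0 m, ∫⁻ b in Ioc 0 m, ∫⁻ c in Ioc 0 m,
      expKer (m - c) * expKer (b - d) * powKer (b - m) * powKer (c - d)) hT
    (by unfold tesseractIntegral; fun_prop) (fun x hx => ?_) (fun x hx => ?_) (fun x hx => ?_)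
  · rw [lintegral_Ioc_tesseract_split
      (w := fun a b c d => expKer (a - c) * expKer (b - d) * powKer (b - a) * powKer (c - d))
      (by fun_prop), h.2]
    · have h0 : tesseractIntegral 0 = 0 := by simp [tesseractIntegral]; ring
      rw [h0, sub_zero]
      exact ⟨h0 ▸ h.1, rfl⟩
    · intro a b c d
      rw [powKer_sub_comm a b, powKer_sub_comm d c]
      ring
    · intro a b c d
      rw [powKer_sub_comm d c, powKer_sub_comm a b, expKer_sub_comm c a, expKer_sub_comm d b]
      ring
  · have hx0 := hx.1
    have hsq : √x * √x = x := mul_self_sqrt hx0.le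
    have hs : √x ≠ 0 := (sqrt_pos.2 hx0).ne'
    have hK := hasDerivAt_halfConv hx0
    have hR := hasDerivAt_gaussInt_sqrt hx0
    have hJ := hasDerivAt_dawsonInt_sqrt hx0
    have hroot := hasDerivAt_sqrt hx0.ne'
    have he := (hasDerivAt_neg x).exp
    have hid := hasDerivAt_id x
    have hq := (hroot.mul he).mul hR
    refine ((((((((((((hid.const_mul 2).mul hJ).sub (hid.const_mul 3)).add
      ((hroot.const_mul 3).mul hK)).sub (hJ.const_mul 2)).add ((hK.pow 2).div_const 4)).sub
      hq).add ((hR.pow 2).div_const 2)).add ((hid.const_mul 2).mul hq)).add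
      ((hid.mul (he.pow 2)).div_const 2)).add
      ((((hid.pow 2).const_mul 2).sub (hid.const_mul 2)).mul (hR.pow 2))).sub
      ((((((hid.pow 2).div_const 2).sub ((hid.const_mul 3).div_const 2)).sub
        (he.const_mul 2)).add ((he.pow 2).div_const 4)).const_mul π) |>.sub_const
        (7 * π / 4)).congr_deriv ?_
    dsimp
    unfold cubeIntegral
    generalize √x = s at *
    subst hsq
    generalize halfConv (s * s) = K
    generalize exp (-(s * s)) = e
    field_simp
    ring
  · exact (lintegral_faces hx.1.le).1
  · rw [← (lintegral_faces hx.1.le).2,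
      ← lintegral_Ioc_reflect _ x]
    refine lintegral_congr fun d => ?_
    rw [← lintegral_Ioc_reflect _ x]
    refine lintegral_congr fun b => ?_
    rw [← lintegral_Ioc_reflect _ x]
    refine lintegral_congr fun c => ?_
    rw [sub_sub_cancel, sub_sub_sub_cancel_left, sub_sub_sub_cancel_left, sub_sub_cancel_left,
      powKer_neg, expKer_sub_comm, powKer_sub_comm d c]

theorem integral_Ioc_toReal {f : ℝ → ENNReal} {T : ℝ} (hT : 0 ≤ T) (hf : Measurable f)
    (h : ∫⁻ x in Ioc 0 T, f x ≠ ⊤) :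
    ∫ x in (0 : ℝ)..T, (f x).toReal = (∫⁻ x in Ioc 0 T, f x).toReal := by
  rw [integral_of_le hT, integral_toReal hf.aemeasurable (ae_lt_top hf h)]

theorem integral_Ioc_toReal₂ {f : ℝ → ℝ → ENNReal} {T : ℝ} (hT : 0 ≤ T)
    (hf : Measurable fun p : ℝ × ℝ => f p.1 p.2)
    (h : ∫⁻ x in Ioc 0 T, ∫⁻ y in Ioc 0 T, f x y ≠ ⊤) :
    ∫ x in (0 : ℝ)..T, ∫ y in (0 : ℝ)..T, (f x y).toReal
      = (∫⁻ x in Ioc 0 T, ∫⁻ y in Ioc 0 T, f x y).toReal := by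
  have hm : Measurable fun x => ∫⁻ y in Ioc 0 T, f x y :=
    measurable_lintegral_Ioc_zero (b := fun _ => T) measurable_const hf
  rw [← integral_Ioc_toReal hT hm h, integral_of_le hT, integral_of_le hT]
  refine integral_congr_ae ?_
  filter_upwards [ae_lt_top hm h] with x hx
  exact integral_Ioc_toReal hT (hf.comp measurable_prodMk_left) hx.ne

theorem integral_Ioc_toReal₃ {f : ℝ → ℝ → ℝ → ENNReal} {T : ℝ} (hT : 0 ≤ T)
    (hf : Measurable fun p : ℝ × ℝ × ℝ => f p.1 p.2.1 p.2.2)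
    (h : ∫⁻ x in Ioc 0 T, ∫⁻ y in Ioc 0 T, ∫⁻ z in Ioc 0 T, f x y z ≠ ⊤) :
    ∫ x in (0 : ℝ)..T, ∫ y in (0 : ℝ)..T, ∫ z in (0 : ℝ)..T, (f x y z).toReal
      = (∫⁻ x in Ioc 0 T, ∫⁻ y in Ioc 0 T, ∫⁻ z in Ioc 0 T, f x y z).toReal := by
  have hm2 : Measurable fun p : ℝ × ℝ => ∫⁻ z in Ioc 0 T, f p.1 p.2 z :=
    measurable_lintegral_Ioc_zero (b := fun _ => T) (f := fun p : ℝ × ℝ => f p.1 p.2)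
      measurable_const (hf.comp (f := fun q : (ℝ × ℝ) × ℝ => (q.1.1, q.1.2, q.2)) (by fun_prop))
  have hm : Measurable fun x => ∫⁻ y in Ioc 0 T, ∫⁻ z in Ioc 0 T, f x y z :=
    measurable_lintegral_Ioc_zero (b := fun _ => T) measurable_const hm2
  rw [← integral_Ioc_toReal hT hm h, integral_of_le hT, integral_of_le hT]
  refine integral_congr_ae ?_
  filter_upwards [ae_lt_top hm h] with x hx
  exact integral_Ioc_toReal₂ hT (hf.comp measurable_prodMk_left) hx.ne

theorem integral_Ioc_toReal₄ {f : ℝ → ℝ → ℝ → ℝ → ENNReal} {T : ℝ} (hT : 0 ≤ T)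
    (hf : Measurable fun p : ℝ × ℝ × ℝ × ℝ => f p.1 p.2.1 p.2.2.1 p.2.2.2)
    (h : ∫⁻ a in Ioc 0 T, ∫⁻ b in Ioc 0 T, ∫⁻ c in Ioc 0 T, ∫⁻ d in Ioc 0 T, f a b c d ≠ ⊤) :
    ∫ a in (0 : ℝ)..T, ∫ b in (0 : ℝ)..T, ∫ c in (0 : ℝ)..T, ∫ d in (0 : ℝ)..T, (f a b c d).toReal
      = (∫⁻ a in Ioc 0 T, ∫⁻ b in Ioc 0 T, ∫⁻ c in Ioc 0 T, ∫⁻ d in Ioc 0 T,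
          f a b c d).toReal := by
  have hm3 : Measurable fun p : (ℝ × ℝ) × ℝ => ∫⁻ z in Ioc 0 T, f p.1.1 p.1.2 p.2 z :=
    measurable_lintegral_Ioc_zero (b := fun _ => T)
      (f := fun p : (ℝ × ℝ) × ℝ => f p.1.1 p.1.2 p.2) measurable_const
      (hf.comp (f := fun q : ((ℝ × ℝ) × ℝ) × ℝ => (q.1.1.1, q.1.1.2, q.1.2, q.2)) (by fun_prop))
  have hm2 : Measurable fun p : ℝ × ℝ => ∫⁻ y in Ioc 0 T, ∫⁻ z in Ioc 0 T, f p.1 p.2 y z :=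
    measurable_lintegral_Ioc_zero (b := fun _ => T) measurable_const hm3
  have hm : Measurable fun x => ∫⁻ b in Ioc 0 T, ∫⁻ y in Ioc 0 T, ∫⁻ z in Ioc 0 T, f x b y z :=
    measurable_lintegral_Ioc_zero (b := fun _ => T) measurable_const hm2
  rw [← integral_Ioc_toReal hT hm h, integral_of_le hT, integral_of_le hT]
  refine integral_congr_ae ?_
  filter_upwards [ae_lt_top hm h] with x hx
  exact integral_Ioc_toReal₃ hT (hf.comp measurable_prodMk_left) hx.ne

/-- Closed form of the squared norm for `H = 3 / 4`. -/
theorem fBmNormSq_three_quarters {T : ℝ} (hT : 0 ≤ T) :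
    fBmNormSq (3 / 4) T = 9 / 16 * tesseractIntegral T := by
  obtain ⟨hnn, hL⟩ := lintegral_tesseract hT
  have hfin : ∫⁻ a in Ioc 0 T, ∫⁻ b in Ioc 0 T, ∫⁻ c in Ioc 0 T, ∫⁻ d in Ioc 0 T,
      expKer (a - c) * expKer (b - d) * powKer (b - a) * powKer (c - d) ≠ ⊤ := by
    rw [hL]; exact ENNReal.mul_ne_top (by norm_num) ENNReal.ofReal_ne_top
  have h := integral_Ioc_toReal₄ hT
    (f := fun a b c d => expKer (a - c) * expKer (b - d) * powKer (b - a) * powKer (c - d))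
    (by fun_prop) hfin
  have hpow : ∀ x : ℝ, |x| ^ (2 * (3 / 4 : ℝ) - 2) = (√|x|)⁻¹ := fun x => by
    rw [sqrt_eq_rpow, ← rpow_neg (abs_nonneg x)]; norm_num
  have hk : ∀ a b c d : ℝ,
      exp (-|a - c| - |b - d|) * |b - a| ^ (2 * (3 / 4 : ℝ) - 2) * |c - d| ^ (2 * (3 / 4 : ℝ) - 2)
      = (expKer (a - c) * expKer (b - d) * powKer (b - a) * powKer (c - d)).toReal := by
    intro a b c d
    rw [hpow, hpow, sub_eq_add_neg (-|a - c|), exp_add]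
    simp only [expKer, powKer, ENNReal.toReal_mul]
    rw [ENNReal.toReal_ofReal (by positivity), ENNReal.toReal_ofReal (by positivity),
      ENNReal.toReal_ofReal (by positivity), ENNReal.toReal_ofReal (by positivity)]
  unfold fBmNormSq
  simp_rw [hk]
  rw [h, hL, ENNReal.toReal_mul, ENNReal.toReal_ofReal hnn]
  norm_num
  ring
end

section
open Set Filter Topology

theorem antitoneOn_Ici_of_hasDerivAt {F f : ℝ → ℝ} {a : ℝ} (hF : ∀ x, a ≤ x → HasDerivAt F (f x) x)
    (hf : ∀ x, a ≤ x → f x ≤ 0) : AntitoneOn F (Ici a) := by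
  refine antitoneOn_of_deriv_nonpos (convex_Ici a)
    (fun x hx => (hF x hx).continuousAt.continuousWithinAt)
    (fun x hx => (hF x (interior_subset hx)).differentiableAt.differentiableWithinAt)
    fun x hx => ?_
  rw [(hF x (interior_subset hx)).deriv]
  exact hf x (interior_subset hx)

theorem monotoneOn_Ici_of_hasDerivAt {F f : ℝ → ℝ} {a : ℝ} (hF : ∀ x, a ≤ x → HasDerivAt F (f x) x)
    (hf : ∀ x, a ≤ x → 0 ≤ f x) : MonotoneOn F (Ici a) := by
  refine monotoneOn_of_deriv_nonneg (convex_Ici a)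
    (fun x hx => (hF x hx).continuousAt.continuousWithinAt)
    (fun x hx => (hF x (interior_subset hx)).differentiableAt.differentiableWithinAt)
    fun x hx => ?_
  rw [(hF x (interior_subset hx)).deriv]
  exact hf x (interior_subset hx)

theorem exists_abs_expSqInt_sub_le :
    ∃ M : ℝ, ∀ y : ℝ, 3 ≤ y →
      |expSqInt y - exp (y ^ 2) * (1 / (2 * y) + 1 / (4 * y ^ 3) + 3 / (8 * y ^ 5))|
        ≤ M * (exp (y ^ 2) / y ^ 7) := by
  set Q : ℝ → ℝ := fun y =>
    expSqInt y - exp (y ^ 2) * (1 / (2 * y) + 1 / (4 * y ^ 3) + 3 / (8 * y ^ 5)) with hQ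
  have hexp : ∀ y : ℝ, HasDerivAt (fun y => exp (y ^ 2)) (exp (y ^ 2) * (2 * y)) y := fun y => by
    simpa using (hasDerivAt_pow 2 y).exp
  have hQd : ∀ y : ℝ, 3 ≤ y → HasDerivAt Q (15 / 8 * (exp (y ^ 2) / y ^ 6)) y := by
    intro y hy
    have hy0 : y ≠ 0 := by linarith
    have h := (hasDerivAt_expSqInt y).sub ((hexp y).mul
      ((((hasDerivAt_const y (1 : ℝ)).fun_div ((hasDerivAt_id y).const_mul 2) (by simpa)).fun_add
        ((hasDerivAt_const y (1 : ℝ)).fun_div ((hasDerivAt_pow 3 y).const_mul 4)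
          (by positivity))).fun_add
        ((hasDerivAt_const y (3 : ℝ)).fun_div ((hasDerivAt_pow 5 y).const_mul 8) (by positivity))))
    refine h.congr_deriv ?_
    simp only [id, Nat.cast_ofNat]
    field_simp
    ring
  have hQ1 : MonotoneOn Q (Ici 3) :=
    monotoneOn_Ici_of_hasDerivAt hQd fun y hy => by positivity
  have hQ2 : AntitoneOn (fun y => Q y - 2 * (exp (y ^ 2) / y ^ 7)) (Ici 3) := by
    refine antitoneOn_Ici_of_hasDerivAt
      (f := fun y => exp (y ^ 2) / y ^ 8 * (14 - 17 / 8 * y ^ 2)) (fun y hy => ?_) fun y hy => ?_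
    · have hy0 : y ≠ 0 := by linarith
      refine ((hQd y hy).sub (((hexp y).fun_div (hasDerivAt_pow 7 y)
        (by positivity)).const_mul 2)).congr_deriv ?_
      simp only [Nat.cast_ofNat]
      field_simp
      ring
    · exact mul_nonpos_of_nonneg_of_nonpos (by positivity) (by nlinarith)
  refine ⟨2 + 5040 * |Q 3|, fun y hy => ?_⟩
  have hy0 : 0 < y := by linarith
  have hlow : 1 ≤ 5040 * (exp (y ^ 2) / y ^ 7) := by
    have h1 := pow_div_factorial_le_exp y hy0.le 7
    have h2 : exp y ≤ exp (y ^ 2) := exp_le_exp.2 (by nlinarith)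
    rw [mul_div_assoc', one_le_div (by positivity)]
    rw [div_le_iff₀ (by positivity)] at h1
    norm_num [Nat.factorial] at h1
    linarith
  have h1 := hQ1 self_mem_Ici hy hy
  have h2 := hQ2 self_mem_Ici hy hy
  have h3 : 0 ≤ exp (y ^ 2) / y ^ 7 := by positivity
  have h4 : 0 ≤ exp ((3 : ℝ) ^ 2) / 3 ^ 7 := by positivity
  have h5 := mul_le_mul_of_nonneg_left hlow (abs_nonneg (Q 3))
  change |Q y| ≤ _
  simp only at h2
  rw [abs_le]
  constructor <;> nlinarith [neg_abs_le (Q 3), le_abs_self (Q 3)]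

theorem exists_abs_halfConv_sub_le :
    ∃ M : ℝ, 0 ≤ M ∧ ∀ T : ℝ, 9 ≤ T →
      |√T * halfConv T - (1 + 1 / (2 * T) + 3 / (4 * T ^ 2))| ≤ M / T ^ 3 := by
  obtain ⟨M, hM⟩ := exists_abs_expSqInt_sub_le
  refine ⟨2 * |M|, by positivity, fun T hT => ?_⟩
  have hT0 : 0 < T := by linarith
  have hs : 3 ≤ √T := le_sqrt_of_sq_le (by linarith)
  have hs0 : 0 < √T := by linarith
  have h := hM _ hs
  have hsq : √T * √T = T := mul_self_sqrt hT0.le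
  rw [sq_sqrt hT0.le] at h
  have hpos : 0 < 2 * √T * exp (-T) := by positivity
  have h2 := mul_le_mul_of_nonneg_left h hpos.le
  rw [← abs_of_pos hpos, ← abs_mul, abs_of_pos hpos] at h2
  have e1 : 2 * √T * exp (-T) * (expSqInt √T - exp T * (1 / (2 * √T) + 1 / (4 * √T ^ 3)
      + 3 / (8 * √T ^ 5))) = √T * halfConv T - (1 + 1 / (2 * T) + 3 / (4 * T ^ 2)) := by
    rw [halfConv, exp_neg]
    have hexp := (exp_pos T).ne'
    generalize exp T = a at *
    generalize √T = s at *
    subst hsq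
    field_simp
    ring
  have e2 : 2 * √T * exp (-T) * (M * (exp T / √T ^ 7)) = 2 * M / T ^ 3 := by
    rw [exp_neg]
    have hexp := (exp_pos T).ne'
    generalize exp T = a at *
    generalize √T = s at *
    subst hsq
    field_simp
  rw [e1, e2] at h2
  refine h2.trans ?_
  gcongr
  exact le_abs_self M

theorem dawsonInt_sqrt_eq {T : ℝ} (hT : 0 ≤ T) :
    dawsonInt √T = ∫ θ in (0 : ℝ)..1, 2 * ((1 - exp (-(T * (1 - θ ^ 2)))) / (1 - θ ^ 2)) := by
  have hscale : ∀ z : ℝ, 4 * exp (-z ^ 2) * expSqInt z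
      = ∫ θ in Ioc (0 : ℝ) 1, 4 * z * exp (-(z ^ 2 * (1 - θ ^ 2))) := by
    intro z
    have h := mul_integral_comp_mul_left (f := fun t => exp (t ^ 2)) (a := 0) (b := 1) z
    rw [mul_zero, mul_one] at h
    rw [expSqInt, ← h, ← integral_of_le zero_le_one, ← intervalIntegral.integral_const_mul,
      ← intervalIntegral.integral_const_mul]
    refine integral_congr fun θ _ => ?_
    rw [show -(z ^ 2 * (1 - θ ^ 2)) = -z ^ 2 + (z * θ) ^ 2 by ring, exp_add]
    ring
  have hint : Integrable (Function.uncurry fun z θ : ℝ => 4 * z * exp (-(z ^ 2 * (1 - θ ^ 2))))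
      ((volume.restrict (uIoc 0 √T)).prod (volume.restrict (Ioc 0 1))) := by
    rw [Measure.prod_restrict]
    refine IntegrableOn.mono_set (t := Icc 0 √T ×ˢ Icc 0 1) ?_ ?_
    · refine ContinuousOn.integrableOn_compact (isCompact_Icc.prod isCompact_Icc) ?_
      unfold Function.uncurry
      fun_prop
    · rw [uIoc_of_le (sqrt_nonneg T)]
      exact prod_mono Ioc_subset_Icc_self Ioc_subset_Icc_self
  rw [dawsonInt, integral_congr fun z _ => hscale z,
    MeasureTheory.intervalIntegral_integral_swap hint, integral_of_le zero_le_one,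
    ← restrict_Ioo_eq_restrict_Ioc]
  refine setIntegral_congr_fun measurableSet_Ioo fun θ hθ => ?_
  have hx : 0 < 1 - θ ^ 2 := by nlinarith [hθ.1, hθ.2]
  have hd : ∀ z : ℝ, HasDerivAt (fun z => -(2 / (1 - θ ^ 2) * exp (-(z ^ 2 * (1 - θ ^ 2)))))
      (4 * z * exp (-(z ^ 2 * (1 - θ ^ 2)))) z := fun z => by
    refine ((((hasDerivAt_pow 2 z).mul_const (1 - θ ^ 2)).neg.exp).const_mul
      (2 / (1 - θ ^ 2))).neg.congr_deriv ?_
    field_simp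
    norm_num
    ring
  rw [integral_eq_sub_of_hasDerivAt (fun z _ => hd z)
    (Continuous.intervalIntegrable (by fun_prop) _ _), sq_sqrt hT]
  simp
  field_simp
  ring

theorem abs_exp_sub_pow_div_le {x : ℝ} (h0 : 0 < x) (h1 : x ≤ 1) (n : ℕ) :
    |(exp (-(n * x)) - (1 - x) ^ n) / x| ≤ n * x * exp (-(n * x)) := by
  have hle : (1 - x) ^ n ≤ exp (-(n * x)) := by
    have h := pow_le_pow_left₀ (by linarith) (one_sub_le_exp_neg x) n
    rwa [← exp_nat_mul, mul_neg] at h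
  have hge : 1 - n * x ^ 2 ≤ (1 - x) ^ n * exp (n * x) := by
    have h := one_add_mul_le_pow (a := -x ^ 2) (by nlinarith) n
    have h' : (1 + -x ^ 2) ^ n ≤ ((1 - x) * exp x) ^ n :=
      pow_le_pow_left₀ (by nlinarith) (by nlinarith [add_one_le_exp x]) n
    rw [mul_pow, ← exp_nat_mul] at h'
    linarith
  have he : exp (n * x) * exp (-(n * x)) = 1 := by rw [← exp_add]; simp
  have hp := exp_pos (-(n * x))
  rw [abs_of_nonneg (div_nonneg (by linarith) h0.le), div_le_iff₀ h0]
  nlinarith [mul_le_mul_of_nonneg_right hge hp.le]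

theorem integral_geom_sum (n : ℕ) :
    ∫ θ in (0 : ℝ)..1, 2 * ∑ j ∈ Finset.range n, θ ^ (2 * j)
      = 2 * (harmonic (2 * n) : ℝ) - harmonic n := by
  rw [intervalIntegral.integral_const_mul, intervalIntegral.integral_finsetSum fun j _ =>
    Continuous.intervalIntegrable (by fun_prop) _ _]
  induction n with
  | zero => simp
  | succ n ih =>
    rw [Finset.sum_range_succ, mul_add, ih, integral_pow, show 2 * (n + 1) = 2 * n + 1 + 1 by ring,
      harmonic_succ, harmonic_succ, harmonic_succ]
    push_cast
    simp
    field_simp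
    ring

theorem tendsto_two_mul_harmonic_sub :
    Tendsto (fun n : ℕ => 2 * (harmonic (2 * n) : ℝ) - harmonic n - log n) atTop
      (𝓝 (2 * log 2 + eulerMascheroniConstant)) := by
  have h := tendsto_harmonic_sub_log
  have h2 := h.comp (tendsto_id.const_mul_atTop' (r := 2) two_pos)
  have h3 := (((h2.const_mul 2).sub h).add_const (2 * log 2))
  rw [show 2 * eulerMascheroniConstant - eulerMascheroniConstant + 2 * log 2
    = 2 * log 2 + eulerMascheroniConstant by ring] at h3
  refine h3.congr' ?_
  filter_upwards [eventually_gt_atTop 0] with n hn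
  simp only [Function.comp, id]
  push_cast
  rw [log_mul two_ne_zero (by positivity)]
  ring

theorem tendsto_dawsonInt_sub_log :
    Tendsto (fun n : ℕ => dawsonInt √n - log n) atTop
      (𝓝 (2 * log 2 + eulerMascheroniConstant)) := by
  set F : ℕ → ℝ → ℝ := fun n θ =>
    2 * ((1 - exp (-(n * (1 - θ ^ 2)))) / (1 - θ ^ 2)) - 2 * ∑ j ∈ Finset.range n, θ ^ (2 * j)
    with hF
  have hae : ∀ᵐ θ : ℝ, θ ≠ 1 := by simp [ae_iff]
  have hFeq : ∀ (n : ℕ) (θ : ℝ), θ ^ 2 ≠ 1 → F n θ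
      = -(2 * ((exp (-(n * (1 - θ ^ 2))) - (1 - (1 - θ ^ 2)) ^ n) / (1 - θ ^ 2))) := by
    intro n θ hθ
    have h1 : 1 - θ ^ 2 ≠ 0 := sub_ne_zero.2 hθ.symm
    simp only [hF, pow_mul]
    rw [geom_sum_eq hθ, sub_sub_cancel, ← neg_sub 1 (θ ^ 2)]
    field_simp
    ring
  have hsq : ∀ θ ∈ Ioc (0 : ℝ) 1, θ ≠ 1 → 0 < 1 - θ ^ 2 ∧ 1 - θ ^ 2 ≤ 1 := fun θ hθ h1 => by
    have : θ < 1 := lt_of_le_of_ne hθ.2 h1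
    constructor <;> nlinarith [hθ.1]
  have hbd : ∀ (n : ℕ), ∀ θ ∈ Ioc (0 : ℝ) 1, θ ≠ 1 →
      ‖F n θ‖ ≤ 2 * (n * (1 - θ ^ 2) * exp (-(n * (1 - θ ^ 2)))) := fun n θ hθ h1 => by
    obtain ⟨h2, h3⟩ := hsq θ hθ h1
    rw [hFeq n θ (by linarith), norm_neg, norm_mul, norm_two, norm_eq_abs]
    exact mul_le_mul_of_nonneg_left (abs_exp_sub_pow_div_le h2 h3 n) two_pos.le
  have hmeas : ∀ n, AEStronglyMeasurable (F n) (volume.restrict (uIoc 0 1)) := fun n => by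
    refine Measurable.aestronglyMeasurable ?_
    simp only [hF]
    fun_prop
  have hbd2 : ∀ n, ∀ᵐ θ : ℝ, θ ∈ uIoc 0 1 → ‖F n θ‖ ≤ 2 := fun n => by
    filter_upwards [hae] with θ h1 hθ
    rw [uIoc_of_le zero_le_one] at hθ
    refine (hbd n θ hθ h1).trans ?_
    have h2 := add_one_le_exp (n * (1 - θ ^ 2))
    have he : exp (n * (1 - θ ^ 2)) * exp (-(n * (1 - θ ^ 2))) = 1 := by rw [← exp_add]; simp
    nlinarith [mul_le_mul_of_nonneg_right h2 (exp_pos (-(n * (1 - θ ^ 2)))).le,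
      exp_pos (-(n * (1 - θ ^ 2)))]
  have hFint : ∀ n, IntervalIntegrable (F n) volume 0 1 := fun n =>
    (intervalIntegrable_const (c := (2 : ℝ))).mono_fun' (hmeas n)
      ((ae_restrict_iff' measurableSet_uIoc).2 (hbd2 n))
  have hlim : Tendsto (fun n => ∫ θ in (0 : ℝ)..1, F n θ) atTop (𝓝 (∫ θ in (0 : ℝ)..1, (0 : ℝ))) := by
    refine intervalIntegral.tendsto_integral_filter_of_dominated_convergence (fun _ => 2)
      (Eventually.of_forall hmeas) (Eventually.of_forall hbd2) ?_ ?_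
    · exact intervalIntegrable_const
    · filter_upwards [hae] with θ h1 hθ
      rw [uIoc_of_le zero_le_one] at hθ
      refine squeeze_zero_norm (fun n => hbd n θ hθ h1) ?_
      have h2 := (tendsto_pow_mul_exp_neg_atTop_nhds_zero 1).comp
        (tendsto_natCast_atTop_atTop.atTop_mul_const (hsq θ hθ h1).1)
      simpa [Function.comp_def] using h2.const_mul 2
  have h3 := tendsto_two_mul_harmonic_sub.add hlim
  rw [intervalIntegral.integral_zero, add_zero] at h3
  refine h3.congr fun n => ?_
  have hgeom : IntervalIntegrable (fun θ : ℝ => 2 * ∑ j ∈ Finset.range n, θ ^ (2 * j)) volume 0 1 :=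
    Continuous.intervalIntegrable (by fun_prop) _ _
  rw [dawsonInt_sqrt_eq n.cast_nonneg, ← integral_geom_sum, sub_add_eq_add_sub,
    ← intervalIntegral.integral_add hgeom (hFint n)]
  simp only [hF, add_sub_cancel]

theorem exists_abs_dawsonInt_sub_le :
    ∃ M : ℝ, 0 ≤ M ∧ ∀ T : ℝ, 9 ≤ T →
      |dawsonInt √T - log T + 1 / (2 * T) + 3 / (8 * T ^ 2)
        - (2 * log 2 + eulerMascheroniConstant)| ≤ M / T ^ 3 := by
  obtain ⟨M, hM0, hM⟩ := exists_abs_halfConv_sub_le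
  set ρ : ℝ → ℝ := fun T => dawsonInt √T - log T + 1 / (2 * T) + 3 / (8 * T ^ 2) with hρ
  have hd : ∀ k T : ℝ, 9 ≤ T → HasDerivAt (fun T => ρ T + k / T ^ 3)
      ((√T * halfConv T - (1 + 1 / (2 * T) + 3 / (4 * T ^ 2)) - 3 * k / T ^ 3) / T) T := by
    intro k T hT
    have hT0 : 0 < T := by linarith
    have hsq : √T * √T = T := mul_self_sqrt hT0.le
    have hs : √T ≠ 0 := (sqrt_pos.2 hT0).ne'
    refine (((((hasDerivAt_dawsonInt_sqrt hT0).sub (hasDerivAt_log hT0.ne')).add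
      ((hasDerivAt_const T (1 : ℝ)).fun_div ((hasDerivAt_id T).const_mul 2) (by simp; positivity))).add
      ((hasDerivAt_const T (3 : ℝ)).fun_div ((hasDerivAt_pow 2 T).const_mul 8) (by positivity))).add
      ((hasDerivAt_const T k).fun_div (hasDerivAt_pow 3 T) (by positivity))).congr_deriv ?_
    simp only [id, Nat.cast_ofNat]
    generalize halfConv T = K
    generalize √T = s at *
    subst hsq
    field_simp
    ring
  have hbound : ∀ T : ℝ, 9 ≤ T → -(M / T ^ 3) ≤ _ ∧ _ ≤ M / T ^ 3 := fun T hT => abs_le.1 (hM T hT)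
  have hanti : AntitoneOn (fun T => ρ T + M / T ^ 3) (Ici 9) :=
    antitoneOn_Ici_of_hasDerivAt (hd M) fun T hT => by
      have hT0 : 0 < T := by linarith
      have := (hbound T hT).2
      have h0 : 0 ≤ M / T ^ 3 := by positivity
      refine div_nonpos_of_nonpos_of_nonneg ?_ hT0.le
      rw [mul_div_assoc]
      linarith
  have hmono : MonotoneOn (fun T => ρ T + -M / T ^ 3) (Ici 9) :=
    monotoneOn_Ici_of_hasDerivAt (hd (-M)) fun T hT => by
      have hT0 : 0 < T := by linarith
      have := (hbound T hT).1
      have h0 : 0 ≤ M / T ^ 3 := by positivity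
      refine div_nonneg ?_ hT0.le
      rw [mul_div_assoc, neg_div]
      linarith
  have hinv : ∀ (k : ℝ) (m : ℕ), m ≠ 0 → Tendsto (fun n : ℕ => k / (n : ℝ) ^ m) atTop (𝓝 0) :=
    fun k m hm => tendsto_const_nhds.div_atTop
      ((tendsto_pow_atTop hm).comp tendsto_natCast_atTop_atTop)
  have hlim : ∀ k : ℝ, Tendsto (fun n : ℕ => ρ n + k / (n : ℝ) ^ 3) atTop
      (𝓝 (2 * log 2 + eulerMascheroniConstant)) := fun k => by
    have h := ((tendsto_dawsonInt_sub_log.add (hinv (1 / 2) 1 one_ne_zero)).add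
      (hinv (3 / 8) 2 two_ne_zero)).add (hinv k 3 three_ne_zero)
    simp only [add_zero] at h
    refine h.congr fun n => ?_
    simp only [hρ, pow_one, div_div]
  refine ⟨M, hM0, fun T hT => ?_⟩
  have hev : ∀ᶠ n : ℕ in atTop, T ≤ n := tendsto_natCast_atTop_atTop.eventually_ge_atTop T
  have h1 := le_of_tendsto (hlim M) (hev.mono fun n hn => hanti hT (hT.trans hn) hn)
  have h2 := ge_of_tendsto (hlim (-M)) (hev.mono fun n hn => hmono hT (hT.trans hn) hn)
  simp only [neg_div] at h1 h2
  change |ρ T - _| ≤ _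
  rw [abs_le]
  constructor <;> linarith

theorem gaussInt_bounds {y : ℝ} (hy : 1 ≤ y) :
    gaussInt y ≤ √π / 2 ∧ √π / 2 - gaussInt y ≤ exp (-y ^ 2) := by
  have hint : IntegrableOn (fun t : ℝ => exp (-t ^ 2)) (Ioi 0) := by
    simpa using (integrable_exp_neg_mul_sq one_pos).integrableOn (s := Ioi (0 : ℝ))
  have hlim : Tendsto gaussInt atTop (𝓝 (√π / 2)) := by
    have h := intervalIntegral_tendsto_integral_Ioi 0 hint tendsto_id
    have h2 := integral_gaussian_Ioi 1
    simp only [neg_mul, one_mul, div_one] at h2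
    rwa [h2] at h
  have hexp : Tendsto (fun y : ℝ => exp (-y ^ 2)) atTop (𝓝 0) :=
    tendsto_exp_neg_atTop_nhds_zero.comp (tendsto_pow_atTop two_ne_zero)
  have hanti : AntitoneOn (fun y => gaussInt y + exp (-y ^ 2)) (Ici 1) := by
    refine antitoneOn_Ici_of_hasDerivAt (f := fun y => exp (-y ^ 2) * (1 - 2 * y))
      (fun y _ => ?_) fun y hy => ?_
    · refine ((hasDerivAt_gaussInt y).add (hasDerivAt_pow 2 y).neg.exp).congr_deriv ?_
      simp only [Nat.cast_ofNat, Pi.neg_apply]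
      ring
    · exact mul_nonpos_of_nonneg_of_nonpos (exp_pos _).le (by linarith)
  have h1 := ge_of_tendsto hlim (eventually_ge_atTop y |>.mono fun x hx => gaussInt_mono hx)
  have h2 := le_of_tendsto (hlim.add hexp)
    (eventually_ge_atTop y |>.mono fun x hx => hanti hy (hy.trans hx) hx)
  exact ⟨h1, by simp only [add_zero] at h2; linarith⟩
end

section

theorem exists_abs_algebraic_part_sub_le :
    ∃ M : ℝ, ∀ T : ℝ, 9 ≤ T →
      |(2 * T - 2) * dawsonInt √T - 3 * T + 3 * √T * halfConv T + halfConv T ^ 2 / 4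
        - (2 * (T - 1) * log T + (2 * (2 * log 2 + eulerMascheroniConstant) - 3) * T + 2
          - 2 * (2 * log 2 + eulerMascheroniConstant) + 2 / T)| ≤ M / T ^ 2 := by
  obtain ⟨M₁, h₁, hJ⟩ := exists_abs_dawsonInt_sub_le
  obtain ⟨M₂, h₂, hK⟩ := exists_abs_halfConv_sub_le
  refine ⟨2 * M₁ + 3 * M₂ + (2 + M₂) * (4 + M₂) + 3, fun T hT => ?_⟩
  have hT0 : 0 < T := by linarith
  have hT1 : 1 ≤ T := by linarith
  have hsq : √T * √T = T := mul_self_sqrt hT0.le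
  have hs : √T ≠ 0 := (sqrt_pos.2 hT0).ne'
  have hJT := hJ T hT
  have hKT := hK T hT
  set r := dawsonInt √T - log T + 1 / (2 * T) + 3 / (8 * T ^ 2)
        - (2 * log 2 + eulerMascheroniConstant) with hr
  set q := √T * halfConv T - (1 + 1 / (2 * T) + 3 / (4 * T ^ 2)) with hq
  set w := √T * halfConv T - 1 with hw
  have hJe : dawsonInt √T = r + log T - 1 / (2 * T) - 3 / (8 * T ^ 2)
      + (2 * log 2 + eulerMascheroniConstant) := by rw [hr]; ring
  have hKe : halfConv T ^ 2 = (1 + w) ^ 2 / T := by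
    rw [hw, add_sub_cancel, mul_pow, sq_sqrt hT0.le]
    field_simp
  have hqe : 3 * √T * halfConv T = 3 * (q + (1 + 1 / (2 * T) + 3 / (4 * T ^ 2))) := by
    rw [hq]; ring
  have hwq : w = q + (1 / (2 * T) + 3 / (4 * T ^ 2)) := by rw [hw, hq]; ring
  have hle : ∀ m n : ℕ, m ≤ n → 1 / T ^ n ≤ 1 / T ^ m := fun m n h => by gcongr
  have hwT : |w| ≤ (2 + M₂) / T := by
    rw [hwq]
    refine (abs_add_le _ _).trans ?_
    rw [abs_of_nonneg (by positivity : 0 ≤ 1 / (2 * T) + 3 / (4 * T ^ 2))]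
    have e1 := mul_le_mul_of_nonneg_left (hle 1 3 (by norm_num)) h₂
    have e2 := hle 1 2 (by norm_num)
    have e3 : 0 < 1 / T := by positivity
    have f1 : 1 / (2 * T) = 1 / 2 * (1 / T) := by field_simp
    have f2 : 3 / (4 * T ^ 2) = 3 / 4 * (1 / T ^ 2) := by field_simp
    rw [f1, f2]
    rw [pow_one] at e1 e2
    rw [div_eq_mul_one_div] at hKT
    rw [div_eq_mul_one_div (2 + M₂)]
    linarith
  have hw2 : |2 + w| ≤ 4 + M₂ := by
    refine (abs_add_le _ _).trans ?_
    rw [abs_two]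
    have : (2 + M₂) / T ≤ 2 + M₂ := div_le_self (by positivity) hT1
    linarith
  have key : (2 * T - 2) * dawsonInt √T - 3 * T + 3 * √T * halfConv T + halfConv T ^ 2 / 4
        - (2 * (T - 1) * log T + (2 * (2 * log 2 + eulerMascheroniConstant) - 3) * T + 2
          - 2 * (2 * log 2 + eulerMascheroniConstant) + 2 / T)
      = (2 * T - 2) * r + 3 * q + w * (2 + w) / (4 * T) + 3 / T ^ 2 := by
    rw [hKe, hqe, hJe]
    field_simp
    ring
  rw [key]
  have b1 : |(2 * T - 2) * r| ≤ 2 * M₁ / T ^ 2 := by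
    rw [abs_mul, abs_of_nonneg (by linarith)]
    calc (2 * T - 2) * |r| ≤ 2 * T * (M₁ / T ^ 3) := by gcongr; linarith
      _ = 2 * M₁ / T ^ 2 := by field_simp
  have b2 : |3 * q| ≤ 3 * M₂ / T ^ 2 := by
    rw [abs_mul, abs_of_pos three_pos]
    calc 3 * |q| ≤ 3 * (M₂ / T ^ 3) := by gcongr
      _ ≤ 3 * (M₂ / T ^ 2) := by gcongr; norm_num
      _ = 3 * M₂ / T ^ 2 := by ring
  have b3 : |w * (2 + w) / (4 * T)| ≤ (2 + M₂) * (4 + M₂) / T ^ 2 := by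
    rw [abs_div, abs_mul, abs_of_pos (by positivity : 0 < 4 * T)]
    calc |w| * |2 + w| / (4 * T) ≤ (2 + M₂) / T * (4 + M₂) / T := by
          gcongr; linarith
      _ = _ := by field_simp
  have b4 : |3 / T ^ 2| = 3 / T ^ 2 := abs_of_pos (by positivity)
  refine (abs_add_le _ _).trans ?_
  have c1 := abs_add_le ((2 * T - 2) * r + 3 * q) (w * (2 + w) / (4 * T))
  have c2 := abs_add_le ((2 * T - 2) * r) (3 * q)
  rw [add_div, add_div, add_div, b4]
  linarith

theorem exists_abs_gaussian_part_sub_le :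
    ∃ M : ℝ, ∀ T : ℝ, 9 ≤ T →
      |(2 * T - 1) * (√T * exp (-T) * gaussInt √T) + T * exp (-T) ^ 2 / 2
          + (2 * T ^ 2 - 2 * T + 1 / 2) * gaussInt √T ^ 2
          - π * (T ^ 2 / 2 - 3 * T / 2 - 2 * exp (-T) + exp (-T) ^ 2 / 4) - 7 * π / 4
        - (π * T - 13 * π / 8)| ≤ M / T ^ 2 := by
  refine ⟨24 * 20, fun T hT => ?_⟩
  have hT0 : 0 < T := by linarith
  have hs1 : 1 ≤ √T := le_sqrt_of_sq_le (by linarith)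
  have hsT : √T ≤ T := by
    have := mul_self_sqrt hT0.le
    nlinarith
  obtain ⟨g1, g2⟩ := gaussInt_bounds hs1
  have g0 := gaussInt_nonneg (sqrt_nonneg T)
  rw [sq_sqrt hT0.le] at g2
  have he0 := exp_pos (-T)
  have he1 : exp (-T) ≤ 1 := exp_le_one_iff.2 (by linarith)
  have hpi4 := pi_le_four
  have hpi0 := pi_pos
  have hpi : √π * √π = π := mul_self_sqrt pi_pos.le
  have hp2 : √π ≤ 2 := by
    rw [sqrt_le_left (by norm_num)]; linarith
  have hT4 : exp (-T) ≤ 24 / T ^ 4 := by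
    have h := pow_div_factorial_le_exp T hT0.le 4
    rw [exp_neg, inv_le_comm₀ (exp_pos T) (by positivity), inv_div]
    simpa [Nat.factorial] using h
  generalize exp (-T) = e at *
  generalize gaussInt √T = R at *
  have hfin : T ^ 2 * e ≤ 24 / T ^ 2 := by
    calc T ^ 2 * e ≤ T ^ 2 * (24 / T ^ 4) := by gcongr
      _ = 24 / T ^ 2 := by field_simp
  have key : (2 * T - 1) * (√T * e * R) + T * e ^ 2 / 2
          + (2 * T ^ 2 - 2 * T + 1 / 2) * R ^ 2
          - π * (T ^ 2 / 2 - 3 * T / 2 - 2 * e + e ^ 2 / 4) - 7 * π / 4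
        - (π * T - 13 * π / 8)
      = (2 * T - 1) * (√T * e * R) + T * e ^ 2 / 2
        - (2 * T ^ 2 - 2 * T + 1 / 2) * ((√π / 2 - R) * (√π / 2 + R)) + π * (2 * e - e ^ 2 / 4) := by
    linear_combination ((2 * T ^ 2 - 2 * T + 1 / 2) / 4) * hpi
  rw [key]
  have hR1 : R ≤ 1 := by linarith
  have hee : e ^ 2 ≤ e := by nlinarith
  have hTe : 0 ≤ T * e := by positivity
  have t1 : 0 ≤ (2 * T - 1) * (√T * e * R) :=
    mul_nonneg (by linarith) (by positivity)
  have t1' : (2 * T - 1) * (√T * e * R) ≤ 2 * T * (T * e * 1) := by gcongr; linarith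
  have t2 : 0 ≤ T * e ^ 2 / 2 := by positivity
  have t2' : T * e ^ 2 / 2 ≤ T ^ 2 * e := by
    have := mul_le_mul_of_nonneg_left hee hT0.le
    nlinarith
  have t3 : 0 ≤ (2 * T ^ 2 - 2 * T + 1 / 2) * ((√π / 2 - R) * (√π / 2 + R)) :=
    mul_nonneg (by nlinarith) (mul_nonneg (by linarith) (by linarith))
  have t3' : (2 * T ^ 2 - 2 * T + 1 / 2) * ((√π / 2 - R) * (√π / 2 + R))
      ≤ 2 * T ^ 2 * (e * 2) := by
    gcongr
    · nlinarith
    · linarith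
  have t4 : 0 ≤ π * (2 * e - e ^ 2 / 4) := mul_nonneg hpi0.le (by linarith)
  have t4' : π * (2 * e - e ^ 2 / 4) ≤ 4 * (2 * e) :=
    mul_le_mul hpi4 (sub_le_self _ (by positivity)) (by linarith) (by norm_num)
  have t5 : e ≤ T ^ 2 * e := le_mul_of_one_le_left he0.le (by nlinarith)
  have t6 : (24 * 20 : ℝ) / T ^ 2 = 20 * (24 / T ^ 2) := by ring
  rw [abs_le, t6]
  constructor <;> linarith
end

theorem stmt_1 :
    ∃ M cM : ℝ, ∀ T > cM,
      |fBmNormSq (3/4) T -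
        (9/8) * ((T - 1) * Real.log T + ((2 * Real.log 2 + Real.eulerMascheroniConstant)
            + (π - 3) / 2) * T
          + 1 - (2 * Real.log 2 + Real.eulerMascheroniConstant) - 13 * π / 16 + 1 / T)|
        ≤ M * T ^ (-2 : ℝ) := by
  obtain ⟨M₁, h₁⟩ := exists_abs_algebraic_part_sub_le
  obtain ⟨M₂, h₂⟩ := exists_abs_gaussian_part_sub_le
  refine ⟨9 / 16 * (M₁ + M₂), 9, fun T hT => ?_⟩
  have hT0 : 0 < T := by linarith
  have hpow : T ^ (-2 : ℝ) = 1 / T ^ 2 := by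
    rw [rpow_neg hT0.le, one_div]
    norm_cast
  have h := (abs_add_le _ _).trans (add_le_add (h₁ T hT.le) (h₂ T hT.le))
  rw [fBmNormSq_three_quarters hT0.le, hpow, mul_one_div, mul_div_assoc (9 / 16), add_div M₁]
  refine le_trans (le_of_eq ?_) (mul_le_mul_of_nonneg_left h (by norm_num : (0 : ℝ) ≤ 9 / 16))
  rw [← abs_of_pos (by norm_num : (0 : ℝ) < 9 / 16), ← abs_mul,
    abs_of_pos (by norm_num : (0 : ℝ) < 9 / 16)]
  congr 1
  rw [tesseractIntegral]
  ring
end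

section
/- Let H ∈ (1/2, 3/4). Then lim_{T→∞} N(T)/(2T) = σ², where σ² = H²Γ(2H)²(4H−1)(1 − 1/cos(2Hπ)). -/
open Real MeasureTheory intervalIntegral Filter

theorem lintegral_comp_abs (f : ℝ → ENNReal) :
    ∫⁻ x, f |x| = 2 * ∫⁻ x in Set.Ioi 0, f x := by
  have h : ∫⁻ x in Set.Iio 0, f |x| = ∫⁻ x in Set.Ioi 0, f x := by
    have := lintegral_image_eq_lintegral_abs_deriv_mul (s := Set.Ioi (0 : ℝ)) (f := fun x => -x)
      (f' := fun _ => -1) measurableSet_Ioi (fun x _ => (hasDerivAt_neg x).hasDerivWithinAt)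
      neg_injective.injOn (fun x => f |x|)
    rw [Set.image_neg_Ioi, neg_zero] at this
    rw [this]
    refine setLIntegral_congr_fun measurableSet_Ioi fun x hx => ?_
    simp [abs_of_pos (Set.mem_Ioi.1 hx)]
  rw [← lintegral_add_compl (fun x => f |x|) (measurableSet_Iic (a := (0 : ℝ))), Set.compl_Iic,
    ← setLIntegral_congr Iio_ae_eq_Iic, h, two_mul]
  congr 1
  exact setLIntegral_congr_fun measurableSet_Ioi fun x hx => by
    rw [abs_of_pos (Set.mem_Ioi.1 hx)]

theorem lintegral_exp_neg_abs_conv_of_nonneg {u : ℝ} (hu : 0 ≤ u) :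
    ∫⁻ w, ENNReal.ofReal (exp (-|u - w| - |w|)) = ENNReal.ofReal ((1 + u) * exp (-u)) := by
  have h1 : ∫⁻ w in Set.Iic 0, ENNReal.ofReal (exp (-|u - w| - |w|))
      = ENNReal.ofReal (exp (-u) / 2) := by
    have : ∫ w in Set.Iic (0:ℝ), exp (-u) * exp (2 * w) = exp (-u) / 2 := by
      rw [MeasureTheory.integral_const_mul, integral_exp_mul_Iic two_pos]; simp; ring
    rw [← this, ofReal_integral_eq_lintegral_ofReal
      ((integrableOn_exp_mul_Iic two_pos 0).const_mul _) (ae_of_all _ fun w => by positivity)]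
    refine setLIntegral_congr_fun measurableSet_Iic fun w hw => ?_
    have hw : w ≤ 0 := hw
    rw [abs_of_nonpos hw, abs_of_nonneg (by linarith), ← exp_add]; ring_nf
  have h2 : ∫⁻ w in Set.Ioc 0 u, ENNReal.ofReal (exp (-|u - w| - |w|))
      = ENNReal.ofReal (u * exp (-u)) := by
    rw [setLIntegral_congr_fun (g := fun _ => ENNReal.ofReal (exp (-u))) measurableSet_Ioc
      fun w hw => by
        simp only
        rw [abs_of_nonneg hw.1.le, abs_of_nonneg (by linarith [hw.2])]; ring_nf]
    rw [setLIntegral_const, Real.volume_Ioc, sub_zero, ← ENNReal.ofReal_mul (exp_pos _).le, mul_comm]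
  have h3 : ∫⁻ w in Set.Ioi u, ENNReal.ofReal (exp (-|u - w| - |w|))
      = ENNReal.ofReal (exp (-u) / 2) := by
    have : ∫ w in Set.Ioi u, exp u * exp ((-2) * w) = exp (-u) / 2 := by
      rw [MeasureTheory.integral_const_mul, integral_exp_mul_Ioi (by norm_num), mul_div_assoc', mul_neg, ← exp_add]
      ring_nf
    rw [← this, ofReal_integral_eq_lintegral_ofReal
      ((integrableOn_exp_mul_Ioi (by norm_num) u).const_mul _)
      (ae_of_all _ fun w => by positivity)]
    refine setLIntegral_congr_fun measurableSet_Ioi fun w hw => ?_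
    have hw : u < w := hw
    rw [abs_of_nonneg (hu.trans hw.le), abs_of_nonpos (by linarith), ← exp_add]; ring_nf
  rw [← lintegral_add_compl _ (measurableSet_Iic (a := (0 : ℝ))), Set.compl_Iic,
    ← Set.Ioc_union_Ioi_eq_Ioi hu, lintegral_union measurableSet_Ioi
      (Set.Ioc_disjoint_Ioi le_rfl), h1, h2, h3, ← ENNReal.ofReal_add (by positivity) (by positivity),
    ← ENNReal.ofReal_add (by positivity) (by positivity)]
  ring_nf

theorem lintegral_exp_neg_abs_conv (u : ℝ) :
    ∫⁻ w, ENNReal.ofReal (exp (-|u - w| - |w|)) = ENNReal.ofReal ((1 + |u|) * exp (-|u|)) := by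
  rcases le_total 0 u with hu | hu
  · rw [lintegral_exp_neg_abs_conv_of_nonneg hu, abs_of_nonneg hu]
  · rw [abs_of_nonpos hu, ← lintegral_exp_neg_abs_conv_of_nonneg (neg_nonneg.2 hu),
      ← lintegral_neg_eq_self]
    refine lintegral_congr fun w => ?_
    rw [abs_neg, ← abs_neg (u - -w)]; ring_nf

theorem lintegral_rpow_mul_one_sub_rpow {a b : ℝ} (ha : 0 < a) (hb : 0 < b) :
    ∫⁻ x in Set.Ioo (0 : ℝ) 1, ENNReal.ofReal (x ^ (a - 1) * (1 - x) ^ (b - 1))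
      = ENNReal.ofReal (ProbabilityTheory.beta a b) := by
  have hB := ProbabilityTheory.beta_pos ha hb
  have h := ProbabilityTheory.lintegral_betaPDF_eq_one ha hb
  rw [ProbabilityTheory.lintegral_betaPDF] at h
  rw [← mul_one (ENNReal.ofReal (ProbabilityTheory.beta a b)), ← h,
    ← lintegral_const_mul' _ _ ENNReal.ofReal_ne_top]
  refine lintegral_congr fun x => ?_
  rw [← ENNReal.ofReal_mul hB.le]
  congr 1
  field_simp

theorem lintegral_abs_rpow_mul_abs_one_sub_rpow {a : ℝ} (ha : 0 < a) (ha' : a < 1 / 2) :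
    ∫⁻ x : ℝ, ENNReal.ofReal (|x| ^ (a - 1) * |1 - x| ^ (a - 1))
      = ENNReal.ofReal (ProbabilityTheory.beta a a + 2 * ProbabilityTheory.beta (1 - 2 * a) a) := by
  have h1 : ∫⁻ x in Set.Ioc (0 : ℝ) 1, ENNReal.ofReal (|x| ^ (a - 1) * |1 - x| ^ (a - 1))
      = ENNReal.ofReal (ProbabilityTheory.beta a a) := by
    rw [← setLIntegral_congr Ioo_ae_eq_Ioc, ← lintegral_rpow_mul_one_sub_rpow ha ha]
    refine setLIntegral_congr_fun measurableSet_Ioo fun x hx => ?_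
    rw [abs_of_pos hx.1, abs_of_pos (sub_pos.2 hx.2)]
  have h2 : ∫⁻ x in Set.Ioi (1 : ℝ), ENNReal.ofReal (|x| ^ (a - 1) * |1 - x| ^ (a - 1))
      = ENNReal.ofReal (ProbabilityTheory.beta (1 - 2 * a) a) := by
    have hi : (fun x : ℝ => x⁻¹) '' Set.Ioo 0 1 = Set.Ioi 1 := by
      ext y
      simp only [Set.mem_image, Set.mem_Ioo, Set.mem_Ioi]
      constructor
      · rintro ⟨x, hx, rfl⟩
        exact (one_lt_inv₀ hx.1).2 hx.2
      · intro hy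
        exact ⟨y⁻¹, ⟨by positivity, inv_lt_one_of_one_lt₀ hy⟩, inv_inv y⟩
    rw [← hi, lintegral_image_eq_lintegral_abs_deriv_mul (f' := fun x => -(x ^ 2)⁻¹)
      measurableSet_Ioo (fun x hx => (hasDerivAt_inv hx.1.ne').hasDerivWithinAt)
      inv_injective.injOn, ← lintegral_rpow_mul_one_sub_rpow (by linarith) ha]
    refine setLIntegral_congr_fun measurableSet_Ioo fun x hx => ?_
    have hx0 := hx.1
    have hx1 : 0 < 1 - x := sub_pos.2 hx.2
    rw [← ENNReal.ofReal_mul (abs_nonneg _)]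
    congr 1
    have e : 1 - x⁻¹ = -((1 - x) * x⁻¹) := by field_simp; ring
    rw [e, abs_neg, abs_neg, abs_of_pos (by positivity), abs_of_pos (by positivity),
      abs_of_pos (by positivity), mul_rpow hx1.le (by positivity), inv_rpow hx0.le,
      ← rpow_neg hx0.le, ← rpow_natCast, ← rpow_neg hx0.le]
    have : x ^ (1 - 2 * a - 1) = x ^ (-((2 : ℕ) : ℝ)) * x ^ (-(a - 1)) * x ^ (-(a - 1)) := by
      rw [← rpow_add hx0, ← rpow_add hx0]; congr 1; push_cast; ring
    rw [this]; ring
  have h3 : ∫⁻ x in Set.Iic (0 : ℝ), ENNReal.ofReal (|x| ^ (a - 1) * |1 - x| ^ (a - 1))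
      = ENNReal.ofReal (ProbabilityTheory.beta (1 - 2 * a) a) := by
    have hi : (fun x : ℝ => 1 - x) '' Set.Ici 1 = Set.Iic 0 := by simp
    rw [← h2, ← hi, lintegral_image_eq_lintegral_abs_deriv_mul (f' := fun x => -1)
      measurableSet_Ici (fun x hx => ((hasDerivAt_id' x).const_sub 1).hasDerivWithinAt)
      sub_right_injective.injOn, setLIntegral_congr Ioi_ae_eq_Ici]
    refine lintegral_congr fun x => ?_
    simp [mul_comm]
  have hB := (ProbabilityTheory.beta_pos ha ha).le
  have hB' := (ProbabilityTheory.beta_pos (show 0 < 1 - 2 * a by linarith) ha).le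
  rw [← lintegral_add_compl _ (measurableSet_Iic (a := (0 : ℝ))), Set.compl_Iic,
    ← Set.Ioc_union_Ioi_eq_Ioi zero_le_one, lintegral_union measurableSet_Ioi
      (Set.Ioc_disjoint_Ioi le_rfl), h1, h2, h3, ← ENNReal.ofReal_add hB hB',
    ← ENNReal.ofReal_add hB' (by positivity)]
  ring_nf

theorem lintegral_abs_rpow_conv {a u : ℝ} (ha : 0 < a) (ha' : a < 1 / 2) (hu : u ≠ 0) :
    ∫⁻ x : ℝ, ENNReal.ofReal (|x| ^ (a - 1) * |u - x| ^ (a - 1))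
      = ENNReal.ofReal (|u| ^ (2 * a - 1) *
        (ProbabilityTheory.beta a a + 2 * ProbabilityTheory.beta (1 - 2 * a) a)) := by
  have hu' := abs_pos.2 hu
  have hi : (fun x : ℝ => u * x) '' Set.univ = Set.univ :=
    Set.image_univ_of_surjective (mul_left_surjective₀ hu)
  rw [ENNReal.ofReal_mul (by positivity), ← lintegral_abs_rpow_mul_abs_one_sub_rpow ha ha',
    ← lintegral_const_mul' _ _ ENNReal.ofReal_ne_top, ← setLIntegral_univ, ← hi,
    lintegral_image_eq_lintegral_abs_deriv_mul (f' := fun x => u * 1)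
      MeasurableSet.univ (fun x hx => ((hasDerivAt_id' x).const_mul u).hasDerivWithinAt)
      (mul_right_injective₀ hu).injOn, setLIntegral_univ]
  refine lintegral_congr fun x => ?_
  rw [← ENNReal.ofReal_mul (abs_nonneg _), ← ENNReal.ofReal_mul (by positivity)]
  congr 1
  have e : u - u * x = u * (1 - x) := by ring
  have : |u| ^ (2 * a - 1) = |u| * |u| ^ (a - 1) * |u| ^ (a - 1) := by
    nth_rw 2 [← rpow_one |u|]
    rw [← rpow_add hu', ← rpow_add hu']; ring_nf
  rw [e, abs_mul u 1, abs_one, abs_mul, mul_rpow hu'.le (abs_nonneg _), abs_mul, mul_rpow hu'.le (abs_nonneg _), this,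
    mul_one]
  ring

theorem lintegral_abs_rpow_mul_one_add_abs_mul_exp {b : ℝ} (hb : 0 < b) :
    ∫⁻ u : ℝ, ENNReal.ofReal (|u| ^ (b - 1) * ((1 + |u|) * exp (-|u|)))
      = ENNReal.ofReal (2 * ((1 + b) * Gamma b)) := by
  rw [lintegral_comp_abs (fun u => ENNReal.ofReal (u ^ (b - 1) * ((1 + u) * exp (-u)))),
    ENNReal.ofReal_mul zero_le_two, ENNReal.ofReal_ofNat]
  congr 1
  have hb1 : 0 < b + 1 := by linarith
  have e : (1 + b) * Gamma b = ∫ u in Set.Ioi (0 : ℝ),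
      (exp (-u) * u ^ (b - 1) + exp (-u) * u ^ (b + 1 - 1)) := by
    rw [integral_add (GammaIntegral_convergent hb) (GammaIntegral_convergent hb1),
      ← Gamma_eq_integral hb, ← Gamma_eq_integral hb1, Gamma_add_one hb.ne']; ring
  have hi : Integrable (fun u : ℝ => exp (-u) * u ^ (b - 1) + exp (-u) * u ^ (b + 1 - 1))
      (volume.restrict (Set.Ioi 0)) :=
    (GammaIntegral_convergent hb).add (GammaIntegral_convergent hb1)
  rw [e, ofReal_integral_eq_lintegral_ofReal hi]
  · refine setLIntegral_congr_fun measurableSet_Ioi fun u hu => ?_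
    have hu : 0 < u := hu
    have : u ^ (b + 1 - 1) = u ^ (b - 1) * u := by
      rw [← rpow_add_one hu.ne']; ring_nf
    rw [this]; ring_nf
  · refine ae_restrict_of_forall_mem measurableSet_Ioi fun u hu => ?_
    have hu : 0 < u := hu
    simp only [Pi.zero_apply]
    positivity

/-- The integrand of `fBmNormSq` after translating `t₂`, `s₁`, `s₂` by `-t₁`, with `a = 2H - 1`. -/
noncomputable def translatedKernel (a : ℝ) (p : ℝ × ℝ × ℝ) : ℝ :=
  exp (-|p.2.1| - |p.1 - p.2.2|) * |p.1| ^ (a - 1) * |p.2.1 - p.2.2| ^ (a - 1)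

theorem translatedKernel_nonneg (a : ℝ) (p : ℝ × ℝ × ℝ) : 0 ≤ translatedKernel a p := by
  unfold translatedKernel; positivity

@[fun_prop]
theorem measurable_translatedKernel (a : ℝ) : Measurable (translatedKernel a) := by
  unfold translatedKernel; fun_prop

theorem lintegral_translatedKernel {a : ℝ} (ha : 0 < a) (ha' : a < 1 / 2) :
    ∫⁻ p, ENNReal.ofReal (translatedKernel a p)
      = ENNReal.ofReal (2 * ((1 + 2 * a) * Gamma (2 * a)) *
        (ProbabilityTheory.beta a a + 2 * ProbabilityTheory.beta (1 - 2 * a) a)) := by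
  set C := ProbabilityTheory.beta a a + 2 * ProbabilityTheory.beta (1 - 2 * a) a with hC
  let F : ℝ → ℝ → ℝ → ENNReal := fun x y w =>
    ENNReal.ofReal (exp (-|y| - |w|) * |x| ^ (a - 1) * |y + w - x| ^ (a - 1))
  have h1 : ∫⁻ p, ENNReal.ofReal (translatedKernel a p) = ∫⁻ x, ∫⁻ y, ∫⁻ w, F x y w := by
    rw [Measure.volume_eq_prod, lintegral_prod _ (by fun_prop)]
    refine lintegral_congr fun x => ?_
    rw [Measure.volume_eq_prod, lintegral_prod _ (by fun_prop)]
    refine lintegral_congr fun y => ?_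
    rw [← lintegral_sub_left_eq_self _ x]
    refine lintegral_congr fun w => ?_
    simp only [F, translatedKernel]
    ring_nf
  have h2 : ∫⁻ x, ∫⁻ y, ∫⁻ w, F x y w = ∫⁻ y, ∫⁻ w, ∫⁻ x, F x y w := by
    rw [lintegral_lintegral_swap]
    · refine lintegral_congr fun y => lintegral_lintegral_swap ?_
      exact Measurable.aemeasurable (by unfold Function.uncurry; fun_prop)
    · refine Measurable.aemeasurable
        (Measurable.lintegral_prod_right' (f := fun p : (ℝ × ℝ) × ℝ => F p.1.1 p.1.2 p.2) ?_)
      fun_prop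
  have h3 (y : ℝ) : ∫⁻ w, ∫⁻ x, F x y w =
      ∫⁻ u, ENNReal.ofReal (exp (-|u - y| - |y|) * (|u| ^ (2 * a - 1) * C)) := by
    rw [← lintegral_sub_right_eq_self _ y]
    refine lintegral_congr_ae ?_
    filter_upwards [(Set.countable_singleton (0 : ℝ)).ae_notMem volume] with u hu
    rw [ENNReal.ofReal_mul (by positivity), ← lintegral_abs_rpow_conv ha ha' hu,
      ← lintegral_const_mul' _ _ ENNReal.ofReal_ne_top]
    refine lintegral_congr fun x => ?_
    rw [← ENNReal.ofReal_mul (by positivity)]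
    simp only [F]
    ring_nf
  have h4 (u : ℝ) : ∫⁻ y, ENNReal.ofReal (exp (-|u - y| - |y|) * (|u| ^ (2 * a - 1) * C)) =
      ENNReal.ofReal (|u| ^ (2 * a - 1) * ((1 + |u|) * exp (-|u|))) * ENNReal.ofReal C := by
    simp_rw [ENNReal.ofReal_mul (exp_pos _).le]
    rw [lintegral_mul_const' _ _ ENNReal.ofReal_ne_top, lintegral_exp_neg_abs_conv,
      ENNReal.ofReal_mul (p := |u| ^ (2 * a - 1)) (by positivity),
      ENNReal.ofReal_mul (p := |u| ^ (2 * a - 1)) (by positivity)]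
    ring
  rw [h1, h2, lintegral_congr h3, lintegral_lintegral_swap, lintegral_congr h4,
    lintegral_mul_const' _ _ ENNReal.ofReal_ne_top,
    lintegral_abs_rpow_mul_one_add_abs_mul_exp (by linarith), ← ENNReal.ofReal_mul]
  · have := Gamma_pos_of_pos (show 0 < 2 * a by linarith)
    positivity
  · exact Measurable.aemeasurable (by unfold Function.uncurry; fun_prop)

theorem integrable_translatedKernel {a : ℝ} (ha : 0 < a) (ha' : a < 1 / 2) :
    Integrable (translatedKernel a) := by
  refine ⟨(measurable_translatedKernel a).aestronglyMeasurable, ?_⟩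
  rw [hasFiniteIntegral_iff_ofReal (ae_of_all _ (translatedKernel_nonneg a)),
    lintegral_translatedKernel ha ha']
  exact ENNReal.ofReal_lt_top

theorem integral_translatedKernel {a : ℝ} (ha : 0 < a) (ha' : a < 1 / 2) :
    ∫ p, translatedKernel a p = 2 * ((1 + 2 * a) * Gamma (2 * a)) *
        (ProbabilityTheory.beta a a + 2 * ProbabilityTheory.beta (1 - 2 * a) a) := by
  rw [integral_eq_lintegral_of_nonneg_ae (ae_of_all _ (translatedKernel_nonneg a))
    (measurable_translatedKernel a).aestronglyMeasurable, lintegral_translatedKernel ha ha',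
    ENNReal.toReal_ofReal]
  have := Gamma_pos_of_pos (show 0 < 2 * a by linarith)
  have := ProbabilityTheory.beta_pos ha ha
  have := ProbabilityTheory.beta_pos (show 0 < 1 - 2 * a by linarith) ha
  positivity

theorem Gamma_two_mul_mul_beta_add {a : ℝ} (ha : 0 < a) (ha' : a < 1 / 2) :
    Gamma (2 * a) * (ProbabilityTheory.beta a a + 2 * ProbabilityTheory.beta (1 - 2 * a) a) =
      Gamma a ^ 2 * (1 + 1 / cos (π * a)) := by
  have h1 := Gamma_mul_Gamma_one_sub a
  have h2 := Gamma_mul_Gamma_one_sub (2 * a)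
  have g1 := (Gamma_pos_of_pos ha).ne'
  have g2 := (Gamma_pos_of_pos (show 0 < 2 * a by linarith)).ne'
  have g3 := (Gamma_pos_of_pos (show 0 < 1 - a by linarith)).ne'
  have hs : sin (π * a) ≠ 0 :=
    (sin_pos_of_pos_of_lt_pi (by positivity) (by nlinarith [pi_pos])).ne'
  have hc : cos (π * a) ≠ 0 :=
    (cos_pos_of_mem_Ioo ⟨by nlinarith [pi_pos], by nlinarith [pi_pos]⟩).ne'
  have e : π * (2 * a) = 2 * (π * a) := by ring
  rw [e, sin_two_mul] at h2
  have h3 : Gamma (2 * a) * Gamma (1 - 2 * a) * (2 * cos (π * a)) = Gamma a * Gamma (1 - a) := by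
    rw [h1, h2]; field_simp
  have e1 : a + a = 2 * a := by ring
  have e2 : 1 - 2 * a + a = 1 - a := by ring
  rw [ProbabilityTheory.beta, ProbabilityTheory.beta, e1, e2]
  generalize cos (π * a) = c at hc h3 ⊢
  field_simp
  linear_combination h3

theorem intervalIntegral_triple_eq_setIntegral {f : ℝ × ℝ × ℝ → ℝ} (hf : Integrable f) {a b : ℝ}
    (hab : a ≤ b) :
    ∫ x in a..b, ∫ y in a..b, ∫ z in a..b, f (x, y, z) =
      ∫ p in Set.Ioc a b ×ˢ Set.Ioc a b ×ˢ Set.Ioc a b, f p := by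
  simp_rw [integral_of_le hab]
  rw [Measure.volume_eq_prod] at hf ⊢
  rw [setIntegral_prod _ hf.integrableOn]
  refine setIntegral_congr_ae measurableSet_Ioc ?_
  filter_upwards [hf.prod_right_ae] with x hx _
  rw [Measure.volume_eq_prod] at hx ⊢
  exact (setIntegral_prod (fun q : ℝ × ℝ => f (x, q)) hx.integrableOn).symm

theorem tendsto_average_setIntegral_translates {f : ℝ × ℝ × ℝ → ℝ} (hf : Integrable f)
    (hm : Measurable f) :
    Tendsto (fun T : ℝ => ∫ v in (0 : ℝ)..1, ∫ p in Set.Ioc (-(T * v)) (T - T * v) ×ˢ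
      Set.Ioc (-(T * v)) (T - T * v) ×ˢ Set.Ioc (-(T * v)) (T - T * v), f p)
      atTop (nhds (∫ p, f p)) := by
  have key := tendsto_integral_filter_of_dominated_convergence (μ := volume) (a := 0) (b := 1)
    (l := atTop) (f := fun _ : ℝ => ∫ p, f p)
    (F := fun T v : ℝ => ∫ p in Set.Ioc (-(T * v)) (T - T * v) ×ˢ
      Set.Ioc (-(T * v)) (T - T * v) ×ˢ Set.Ioc (-(T * v)) (T - T * v), f p)
    (fun _ => ∫ p, |f p|) ?_ ?_ intervalIntegrable_const ?_
  · simpa using key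
  · refine Eventually.of_forall fun T => StronglyMeasurable.aestronglyMeasurable ?_
    have hs : MeasurableSet {q : ℝ × (ℝ × ℝ × ℝ) | q.2 ∈ Set.Ioc (-(T * q.1)) (T - T * q.1) ×ˢ
        Set.Ioc (-(T * q.1)) (T - T * q.1) ×ˢ Set.Ioc (-(T * q.1)) (T - T * q.1)} := by
      simp only [Set.mem_prod, Set.mem_Ioc]
      measurability
    have := ((hm.comp measurable_snd).indicator hs).stronglyMeasurable.integral_prod_right'
      (ν := (volume : Measure (ℝ × ℝ × ℝ)))
    convert this using 2 with v
    rw [← MeasureTheory.integral_indicator (measurableSet_Ioc.prod (measurableSet_Ioc.prod measurableSet_Ioc))]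
    rfl
  · refine Eventually.of_forall fun T => ae_of_all _ fun v _ => ?_
    refine (MeasureTheory.norm_integral_le_integral_norm _).trans ?_
    exact setIntegral_le_integral hf.norm (ae_of_all _ fun p => norm_nonneg _)
  · filter_upwards [(Set.countable_singleton (1 : ℝ)).ae_notMem volume] with v hv hv'
    rw [Set.uIoc_of_le zero_le_one] at hv'
    have hv1 : 0 < 1 - v := sub_pos.2 (lt_of_le_of_ne hv'.2 hv)
    have hlo : Tendsto (fun T : ℝ => -(T * v)) atTop atBot :=
      tendsto_neg_atTop_atBot.comp (tendsto_id.atTop_mul_const hv'.1)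
    have hhi : Tendsto (fun T : ℝ => T - T * v) atTop atTop := by
      refine (tendsto_id.atTop_mul_const hv1).congr fun T => ?_
      simp only [id]; ring
    refine AECover.integral_tendsto_of_countably_generated ⟨ae_of_all _ fun p => ?_, fun T =>
      measurableSet_Ioc.prod (measurableSet_Ioc.prod measurableSet_Ioc)⟩ hf
    have hx (x : ℝ) : ∀ᶠ T : ℝ in atTop, x ∈ Set.Ioc (-(T * v)) (T - T * v) :=
      (hlo.eventually_lt_atBot x).and (hhi.eventually_ge_atTop x)
    filter_upwards [hx p.1, hx p.2.1, hx p.2.2] with T h1 h2 h3 using ⟨h1, h2, h3⟩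

theorem fBmNormSq_eq {H T : ℝ} (hH : 1 / 2 < H) (hH' : H < 3 / 4) (hT : 0 ≤ T) :
    fBmNormSq H T = H ^ 2 * (2 * H - 1) ^ 2 * (T * ∫ v in (0 : ℝ)..1,
      ∫ p in Set.Ioc (-(T * v)) (T - T * v) ×ˢ Set.Ioc (-(T * v)) (T - T * v) ×ˢ
        Set.Ioc (-(T * v)) (T - T * v), translatedKernel (2 * H - 1) p) := by
  have hi := integrable_translatedKernel (a := 2 * H - 1) (by linarith) (by linarith)
  rw [fBmNormSq, mul_integral_comp_mul_left (f := fun t => ∫ p in Set.Ioc (-t) (T - t) ×ˢ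
    Set.Ioc (-t) (T - t) ×ˢ Set.Ioc (-t) (T - t), translatedKernel (2 * H - 1) p),
    mul_zero, mul_one]
  congr 1
  refine integral_congr fun t _ => ?_
  rw [← intervalIntegral_triple_eq_setIntegral hi (by linarith : -t ≤ T - t), ← zero_sub t]
  simp_rw [← integral_comp_sub_right (fun x => _) t]
  refine integral_congr fun x _ => integral_congr fun y _ => integral_congr fun z _ => ?_
  simp only [translatedKernel]
  have e : 2 * H - 1 - 1 = 2 * H - 2 := by ring
  rw [e, sub_sub_sub_cancel_right, sub_sub_sub_cancel_right, abs_sub_comm y t]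

theorem stmt_3 (H : ℝ) (hH : H ∈ Set.Ioo (1/2 : ℝ) (3/4)) :
    Tendsto (fun T : ℝ => fBmNormSq H T / (2 * T)) atTop
      (nhds (H ^ 2 * (Real.Gamma (2 * H)) ^ 2 * (4 * H - 1) *
        (1 - 1 / Real.cos (2 * H * π)))) := by
  have h0 : 0 < 2 * H - 1 := by linarith [hH.1]
  have h1 : 2 * H - 1 < 1 / 2 := by linarith [hH.2]
  have lim := (tendsto_average_setIntegral_translates (integrable_translatedKernel h0 h1)
    (measurable_translatedKernel _)).const_mul (H ^ 2 * (2 * H - 1) ^ 2 / 2)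
  have hG : Gamma (2 * H) = (2 * H - 1) * Gamma (2 * H - 1) := by
    rw [← Gamma_add_one h0.ne']; ring_nf
  have hcos : cos (2 * H * π) = -cos (π * (2 * H - 1)) := by
    rw [← cos_add_pi]; ring_nf
  have hval : H ^ 2 * (2 * H - 1) ^ 2 / 2 * ∫ p, translatedKernel (2 * H - 1) p =
      H ^ 2 * (Real.Gamma (2 * H)) ^ 2 * (4 * H - 1) * (1 - 1 / Real.cos (2 * H * π)) := by
    rw [integral_translatedKernel h0 h1, hG, hcos, div_neg, sub_neg_eq_add]
    linear_combination H ^ 2 * (2 * H - 1) ^ 2 * (4 * H - 1) * Gamma_two_mul_mul_beta_add h0 h1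
  rw [hval] at lim
  refine lim.congr' ?_
  filter_upwards [eventually_gt_atTop 0] with T hT
  rw [fBmNormSq_eq hH.1 hH.2 hT.le]
  field_simp
end
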